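/- Let d ≥ 1, N ≥ 1, let Q ⊂ ℝ^d be a cube of volume |Q|, let u ∈ C_c^∞((ℝ^d)^N; ℂ), and define the one-particle density ρ(x) := ∑_{j=1}^N ∫ |u(x_1,…,x_{j−1}, x, x_{j+1},…,x_N)|² ∏_{k≠j} dx_k; assume ∫_Q ρ > 0. Then for every ε ∈ (0, 1), the free local kinetic energy T₀^Q := (1/2)·∑_{j=1}^N ∫ ‖∇_j u‖²·χ_Q(x_j) dx satisfies the local uncertainty principle T₀^Q ≥ (C′_d/2)·ε^{1+4/d} · ( ∫_Q ρ^{1+2/d} dx ) / (∫_Q ρ)^{2/d} − (C′_d/2)·( 1 + (ε/(1−ε))^{1+4/d} ) · (∫_Q ρ) / |Q|^{2/d}, where C′_1 = π²/60 and C′_d = (π²/4)·d^{2−2/d}/((d+2)(d+4)) for d ≥ 2. -/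

import Mathlib

open MeasureTheory

/-- `∫ |u|²` over all particle coordinates except the `j`-th one, which is set to `y`. -/
noncomputable def densityAt {d N : ℕ} (u : (Fin N → EuclideanSpace ℝ (Fin d)) → ℂ)
    (j : Fin N) (y : EuclideanSpace ℝ (Fin d)) : ℝ :=
  ∫ z : {k : Fin N // k ≠ j} → EuclideanSpace ℝ (Fin d),
    ‖u (fun k => if h : k = j then y else z ⟨k, h⟩)‖ ^ 2

/-- In the off-diagonal box estimate, every coordinate other than a maximal one takes few values. -/
lemma two_mul_add_one_sq_le {n : ℕ} (hn : n ≠ 2) {a b : ℤ} (ha : 1 ≤ a) (hb : 0 ≤ b) (hab : b ≤ a)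
    (h : a ^ 2 + b ^ 2 ≤ n) : (2 * b + 1) ^ 2 ≤ 4 * (n : ℤ) := by
  rcases eq_or_lt_of_le ha with rfl | ha
  · have : b = 0 ∨ b = 1 := by omega
    rcases this with rfl | rfl
    · norm_num at h ⊢; omega
    · norm_num at h ⊢; omega
  · nlinarith

lemma card_Icc_neg_natCast (b : ℕ) : (Finset.Icc (-(b : ℤ)) b).card = 2 * b + 1 := by
  rw [Int.card_Icc]; omega

lemma card_le_of_maximal_coordinate {n d : ℕ} {S : Finset (Fin d → ℤ)}
    (hS : ∀ m ∈ S, ∃ i, m i ≠ 0 ∧ (m i) ^ 2 ≤ n ∧ ∀ k, k ≠ i → (2 * |m k| + 1) ^ 2 ≤ 4 * (n : ℤ)) :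
    (S.card : ℝ) ≤ d * (2 * √n) ^ d := by
  classical
  set A := Nat.sqrt n
  set B := (Nat.sqrt (4 * n) - 1) / 2
  let box : Fin d → Finset (Fin d → ℤ) := fun i => Fintype.piFinset fun k =>
    if k = i then (Finset.Icc (-(A : ℤ)) A).erase 0 else Finset.Icc (-(B : ℤ)) B
  have hAn : (A : ℝ) ≤ √n := by
    apply Real.le_sqrt_of_sq_le
    exact_mod_cast Nat.sqrt_le' n
  have hsub : S ⊆ Finset.univ.biUnion box := by
    intro m hm
    obtain ⟨i, h0, h1, h2⟩ := hS m hm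
    simp only [Finset.mem_biUnion, Finset.mem_univ, true_and, box, Fintype.mem_piFinset]
    refine ⟨i, fun k => ?_⟩
    split_ifs with hk
    · subst hk
      simp only [Finset.mem_erase, ne_eq, h0, not_false_eq_true, Finset.mem_Icc, true_and]
      rw [← abs_le]
      have : (m k).natAbs ≤ A := by
        rw [Nat.le_sqrt']
        zify; simpa using h1
      rw [Int.abs_eq_natAbs]
      omega
    · rw [Finset.mem_Icc, ← abs_le]
      have : 2 * (m k).natAbs + 1 ≤ Nat.sqrt (4 * n) := by
        rw [Nat.le_sqrt']
        zify; exact h2 k hk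
      rw [Int.abs_eq_natAbs]
      omega
  have hbox : ∀ i, ((box i).card : ℝ) ≤ (2 * √n) ^ d := by
    intro i
    by_cases hn : n = 0
    · subst hn
      have : box i = ∅ := by
        rw [Fintype.piFinset_eq_empty]
        exact ⟨i, by simp [A]⟩
      rw [this]; simp
    · have hB : ((2 * B + 1 : ℕ) : ℝ) ≤ 2 * √n := by
        have h1 : 2 * B + 1 ≤ Nat.sqrt (4 * n) := by
          have : 1 ≤ Nat.sqrt (4 * n) := by rw [Nat.le_sqrt']; omega
          omega
        have h2 : (2 * B + 1) ^ 2 ≤ 4 * n := Nat.le_sqrt'.1 h1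
        have h3 : ((2 * B + 1 : ℕ) : ℝ) ≤ √(4 * n) := by
          apply Real.le_sqrt_of_sq_le
          exact_mod_cast h2
        rwa [Real.sqrt_mul (by norm_num), show (4 : ℝ) = 2 ^ 2 by norm_num,
          Real.sqrt_sq (by norm_num)] at h3
      rw [Fintype.card_piFinset]
      push_cast
      calc _ ≤ ∏ _k : Fin d, (2 * √(n : ℝ)) := by
            apply Finset.prod_le_prod
            · intros; positivity
            · intro k _
              split_ifs
              · rw [Finset.card_erase_of_mem (by simp), card_Icc_neg_natCast]
                push_cast; simpa using hAn
              · rw [card_Icc_neg_natCast]; exact hB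
        _ = _ := by simp
  calc (S.card : ℝ) ≤ (Finset.univ.biUnion box).card := by exact_mod_cast Finset.card_le_card hsub
    _ ≤ ∑ i, ((box i).card : ℝ) := by exact_mod_cast Finset.card_biUnion_le
    _ ≤ ∑ _i : Fin d, (2 * √(n : ℝ)) ^ d := Finset.sum_le_sum fun i _ => hbox i
    _ = _ := by simp

lemma card_le_of_sum_sq_le_two {d : ℕ} {S : Finset (Fin d → ℤ)} (hd : 2 ≤ d)
    (hS : ∀ m ∈ S, m ≠ 0 ∧ ∑ i, (m i) ^ 2 ≤ 2) :
    (S.card : ℝ) ≤ d * (2 * √2) ^ d := by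
  classical
  let f : (Fin d × Fin d) × (Bool × Bool) → (Fin d → ℤ) := fun p k =>
    if k = p.1.1 then (if p.2.1 then 1 else -1) else
      if k = p.1.2 then (if p.2.2 then 1 else -1) else 0
  have hsub : S ⊆ Finset.univ.image f := by
    intro m hm
    obtain ⟨h0, h2⟩ := hS m hm
    have hsq : ∀ T : Finset (Fin d), ∑ i ∈ T, (m i) ^ 2 ≤ 2 := fun T =>
      (Finset.sum_le_univ_sum_of_nonneg fun i => sq_nonneg _).trans h2
    have hval : ∀ i, m i ≠ 0 → m i = 1 ∨ m i = -1 := by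
      intro i hi
      have := hsq {i}
      simp only [Finset.sum_singleton] at this
      have h1 : m i < 2 := by nlinarith
      have h2 : -2 < m i := by nlinarith
      omega
    obtain ⟨i, hi⟩ := Function.ne_iff.1 h0
    simp only [Pi.zero_apply] at hi
    rw [Finset.mem_image]
    by_cases hex : ∃ k, k ≠ i ∧ m k ≠ 0
    · obtain ⟨k, hki, hk⟩ := hex
      refine ⟨((i, k), (decide (m i = 1), decide (m k = 1))), Finset.mem_univ _, ?_⟩
      funext l
      simp only [f, decide_eq_true_eq]
      split_ifs with h1 h2 h3 h4
      · rw [h1, h2]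
      · rw [h1]; rcases hval i hi with h | h <;> simp_all
      · rw [h3, h4]
      · rw [h3]; rcases hval k hk with h | h <;> simp_all
      · by_contra hl
        have := hsq {l, k, i}
        rw [Finset.sum_insert (by simp [h1, h3]), Finset.sum_insert (by simp [hki]),
          Finset.sum_singleton] at this
        have hh : ∀ j, m j ≠ 0 → 1 ≤ (m j) ^ 2 := fun j hj => by
          have : 0 < (m j) ^ 2 := by positivity
          omega
        have := hh l (Ne.symm hl)
        have := hh k hk
        have := hh i hi
        omega
    · push Not at hex
      refine ⟨((i, i), (decide (m i = 1), true)), Finset.mem_univ _, ?_⟩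
      funext l
      simp only [f, decide_eq_true_eq]
      split_ifs with h1 h2
      · rw [h1, h2]
      · rw [h1]; rcases hval i hi with h | h <;> simp_all
      · exact (hex l h1).symm
  have hcard : S.card ≤ d * d * 4 := by
    refine (Finset.card_le_card hsub).trans (Finset.card_image_le.trans ?_)
    simp
  have hpow : ∀ k : ℕ, ((k + 2 : ℕ) : ℝ) * 4 ≤ (2 * √2) ^ (k + 2) := by
    have h2 : √2 ^ 2 = 2 := Real.sq_sqrt (by norm_num)
    have h14 : (1.4 : ℝ) ≤ √2 := Real.le_sqrt_of_sq_le (by norm_num)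
    intro k
    induction k with
    | zero => rw [zero_add, mul_pow, h2]; norm_num
    | succ k ih =>
      rw [show k + 1 + 2 = (k + 2) + 1 by ring, pow_succ]
      push_cast at ih ⊢
      have hk : (0 : ℝ) ≤ k := Nat.cast_nonneg k
      calc ((k : ℝ) + 2 + 1) * 4 ≤ (k + 2) * 4 * 2.8 := by nlinarith
        _ ≤ (2 * √2) ^ (k + 2) * (2 * √2) := by
          apply mul_le_mul ih (by linarith) (by norm_num) (by positivity)
  obtain ⟨k, rfl⟩ := Nat.exists_eq_add_of_le' hd
  calc (S.card : ℝ) ≤ ((k + 2) * (k + 2) * 4 : ℕ) := by exact_mod_cast hcard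
    _ = ((k + 2 : ℕ) : ℝ) * (((k + 2 : ℕ) : ℝ) * 4) := by push_cast; ring
    _ ≤ _ := by gcongr; exact hpow k

/-- A ball of squared radius `n` in `ℝ^d` contains at most `1 + d (2 √n)^d` lattice points. -/
theorem card_lattice_le {n d : ℕ} (hd : 1 ≤ d) {S : Finset (Fin d → ℤ)}
    (hS : ∀ m ∈ S, ∑ i, (m i) ^ 2 ≤ (n : ℤ)) :
    (S.card : ℝ) ≤ 1 + d * (2 * √n) ^ d := by
  classical
  have key : ((S.erase 0).card : ℝ) ≤ d * (2 * √n) ^ d := by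
    by_cases h2 : n = 2 ∧ 2 ≤ d
    · obtain ⟨rfl, h2⟩ := h2
      refine card_le_of_sum_sq_le_two h2 fun m hm => ?_
      rw [Finset.mem_erase] at hm
      exact ⟨hm.1, by exact_mod_cast hS m hm.2⟩
    · refine card_le_of_maximal_coordinate fun m hm => ?_
      rw [Finset.mem_erase] at hm
      obtain ⟨hm0, hmS⟩ := hm
      have hsq : ∀ T : Finset (Fin d), ∑ i ∈ T, (m i) ^ 2 ≤ n := fun T =>
        (Finset.sum_le_univ_sum_of_nonneg fun i => sq_nonneg _).trans (hS m hmS)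
      have : Nonempty (Fin d) := ⟨⟨0, hd⟩⟩
      obtain ⟨i, hi⟩ := Finite.exists_max fun i => |m i|
      have hi0 : m i ≠ 0 := by
        intro h0
        apply hm0
        funext k
        have := hi k
        rw [h0, abs_zero, abs_nonpos_iff] at this
        exact this
      refine ⟨i, hi0, by simpa using hsq {i}, fun k hk => ?_⟩
      have hn : n ≠ 2 := by
        rintro rfl
        apply h2 ⟨rfl, ?_⟩
        by_contra hlt
        have : d = 1 := by omega
        subst this
        exact hk (Subsingleton.elim _ _)
      apply two_mul_add_one_sq_le hn (a := |m i|) (Int.one_le_abs hi0) (abs_nonneg _) (hi k)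
      have := hsq {i, k}
      rw [Finset.sum_pair hk.symm] at this
      simpa using this
  have : S.card ≤ (S.erase 0).card + 1 := by
    have := Finset.pred_card_le_card_erase (s := S) (a := 0); omega
  have : (S.card : ℝ) ≤ (S.erase 0).card + 1 := by exact_mod_cast this
  linarith

lemma integral_sub_mul_rpow_sq {A B α : ℝ} (hA : 0 ≤ A) (hB : 0 < B) (hα : 0 < α) :
    ∫ x in (0 : ℝ)..(A / B) ^ (1 / α), (A - B * x ^ α) ^ 2 =
      2 * α ^ 2 / ((1 + α) * (1 + 2 * α)) * (A ^ 2 * (A / B) ^ (1 / α)) := by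
  set L := (A / B) ^ (1 / α)
  have hAB : 0 ≤ A / B := by positivity
  have hL : 0 ≤ L := Real.rpow_nonneg hAB _
  have hLα : B * L ^ α = A := by
    rw [← Real.rpow_mul hAB, one_div, inv_mul_cancel₀ hα.ne', Real.rpow_one]
    field_simp
  have h1 : ∫ x in (0 : ℝ)..L, (A - B * x ^ α) ^ 2 =
      ∫ x in (0 : ℝ)..L, (A ^ 2 - 2 * A * B * x ^ α + B ^ 2 * x ^ (2 * α)) := by
    apply intervalIntegral.integral_congr
    intro x hx
    rw [Set.uIcc_of_le hL] at hx
    simp only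
    rw [mul_comm 2 α, Real.rpow_mul hx.1, Real.rpow_two]
    ring
  have hi : ∀ β : ℝ, 0 < β → IntervalIntegrable (fun x : ℝ => x ^ β) volume 0 L := fun β hβ =>
    intervalIntegral.intervalIntegrable_rpow' (by linarith)
  rw [h1, intervalIntegral.integral_add, intervalIntegral.integral_sub,
    intervalIntegral.integral_const_mul, intervalIntegral.integral_const_mul,
    intervalIntegral.integral_const, integral_rpow (Or.inl (by linarith)),
    integral_rpow (Or.inl (by linarith)), Real.zero_rpow (by positivity),
    Real.zero_rpow (by positivity), Real.rpow_add_one' hL (by positivity),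
    Real.rpow_add_one' hL (by positivity), mul_comm 2 α, Real.rpow_mul hL, Real.rpow_two]
  · have e1 : L ^ α = A / B := by rw [← hLα]; field_simp
    rw [e1]
    simp only [smul_eq_mul, sub_zero]
    field_simp
    ring
  · exact intervalIntegrable_const
  · exact (hi α hα).const_mul _
  · exact intervalIntegrable_const.sub ((hi α hα).const_mul _)
  · exact (hi _ (by positivity)).const_mul _

lemma ofReal_le_lintegral_sub_mul_rpow_sq {A B α : ℝ} (hA : 0 ≤ A) (hB : 0 < B) (hα : 0 < α) :
    ENNReal.ofReal (2 * α ^ 2 / ((1 + α) * (1 + 2 * α)) * (A ^ 2 * (A / B) ^ (1 / α))) ≤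
      ∫⁻ x in Set.Ioi (0 : ℝ), ENNReal.ofReal (A - B * x ^ α) ^ 2 := by
  have hAB : 0 ≤ A / B := by positivity
  have hL : 0 ≤ (A / B) ^ (1 / α) := Real.rpow_nonneg hAB _
  have hcont : Continuous fun x : ℝ => (A - B * x ^ α) ^ 2 :=
    (continuous_const.sub (continuous_const.mul (Real.continuous_rpow_const hα.le))).pow 2
  rw [← integral_sub_mul_rpow_sq hA hB hα, intervalIntegral.integral_of_le hL,
    ofReal_integral_eq_lintegral_ofReal]
  · calc _ = ∫⁻ x in Set.Ioc 0 ((A / B) ^ (1 / α)), ENNReal.ofReal (A - B * x ^ α) ^ 2 := by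
          apply setLIntegral_congr_fun measurableSet_Ioc
          intro x hx
          have : x ^ α ≤ A / B := by
            calc x ^ α ≤ ((A / B) ^ (1 / α)) ^ α := Real.rpow_le_rpow hx.1.le hx.2 hα.le
              _ = A / B := by
                rw [← Real.rpow_mul hAB, one_div, inv_mul_cancel₀ hα.ne', Real.rpow_one]
          rw [le_div_iff₀ hB] at this
          exact ENNReal.ofReal_pow (by linarith) 2
      _ ≤ _ := lintegral_mono_set Set.Ioc_subset_Ioi_self
  · exact (hcont.intervalIntegrable _ _).1
  · exact Filter.Eventually.of_forall fun x => sq_nonneg _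

lemma rpow_mul_rpow_add_le {a b p ε : ℝ} (ha : 0 ≤ a) (hb : 0 ≤ b) (hp : 1 ≤ p)
    (hε0 : 0 < ε) (hε1 : ε < 1) :
    ε ^ (p - 1) * (a + b) ^ p ≤ a ^ p + (ε / (1 - ε)) ^ (p - 1) * b ^ p := by
  have h1 : 0 < 1 - ε := by linarith
  have h := (convexOn_rpow hp).2 (x := a / ε) (y := b / (1 - ε)) (Set.mem_Ici.2 (by positivity))
    (Set.mem_Ici.2 (by positivity)) hε0.le h1.le (by ring)
  simp only [smul_eq_mul] at h
  rw [mul_div_cancel₀ _ hε0.ne', mul_div_cancel₀ _ h1.ne', Real.div_rpow ha hε0.le,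
    Real.div_rpow hb h1.le] at h
  have e1 : ε ^ p = ε ^ (p - 1) * ε := by
    rw [← Real.rpow_add_one hε0.ne']; congr 1; ring
  have e2 : (1 - ε) ^ p = (1 - ε) ^ (p - 1) * (1 - ε) := by
    rw [← Real.rpow_add_one h1.ne']; congr 1; ring
  have p1 : 0 < ε ^ (p - 1) := Real.rpow_pos_of_pos hε0 _
  have p2 : 0 < (1 - ε) ^ (p - 1) := Real.rpow_pos_of_pos h1 _
  calc ε ^ (p - 1) * (a + b) ^ p
      ≤ ε ^ (p - 1) * (ε * (a ^ p / ε ^ p) + (1 - ε) * (b ^ p / (1 - ε) ^ p)) := by gcongr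
    _ = _ := by
      rw [e1, e2, Real.div_rpow hε0.le h1.le]
      field_simp

/-- The energy integral of the squared positive part, at a fixed point. -/
lemma ofReal_le_lintegral_tsub_sqrt_sq {d : ℕ} (hd : 1 ≤ d) {r μ l ε : ℝ} (hr : 0 ≤ r) (hμ : 0 < μ)
    (hl : 0 < l) (hε0 : 0 < ε) (hε1 : ε < 1) :
    ENNReal.ofReal (l / 4 * (d : ℝ) ^ ((2 : ℝ) - 2 / d) / ((d + 2) * (d + 4)) *
        μ ^ (-(4 : ℝ) / d) * (ε ^ ((1 : ℝ) + 4 / d) * r ^ ((2 : ℝ) + 4 / d))) ≤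
      (∫⁻ E in Set.Ioi (0 : ℝ), (ENNReal.ofReal r -
        ENNReal.ofReal (μ * √(1 + d * (2 * √(E / l)) ^ d))) ^ 2) +
      ENNReal.ofReal (l / 4 * (d : ℝ) ^ ((2 : ℝ) - 2 / d) / ((d + 2) * (d + 4)) *
        μ ^ (-(4 : ℝ) / d) * ((ε / (1 - ε)) ^ ((1 : ℝ) + 4 / d) * μ ^ ((2 : ℝ) + 4 / d))) := by
  have hd0 : (0 : ℝ) < d := by exact_mod_cast hd
  set A := max 0 (r - μ)
  have hA : 0 ≤ A := le_max_left _ _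
  set b := √d * (4 / l) ^ ((d : ℝ) / 4)
  have hb : 0 < b := by positivity
  set κ := l / 4 * (d : ℝ) ^ ((2 : ℝ) - 2 / d) / ((d + 2) * (d + 4)) * μ ^ (-(4 : ℝ) / d)
  have hκ : 0 ≤ κ := by positivity
  have hbpow : b ^ (4 / (d : ℝ)) = d ^ (2 / (d : ℝ)) * (4 / l) := by
    rw [Real.mul_rpow (by positivity) (by positivity), ← Real.rpow_mul (by positivity),
      Real.sqrt_eq_rpow, ← Real.rpow_mul hd0.le]
    congr 2
    · ring
    · rw [show (d : ℝ) / 4 * (4 / d) = 1 by field_simp, Real.rpow_one]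
  have hinteg : ENNReal.ofReal (κ * A ^ ((2 : ℝ) + 4 / d)) ≤
      ∫⁻ E in Set.Ioi (0 : ℝ), (ENNReal.ofReal r -
        ENNReal.ofReal (μ * √(1 + d * (2 * √(E / l)) ^ d))) ^ 2 := by
    have h := ofReal_le_lintegral_sub_mul_rpow_sq (α := (d : ℝ) / 4) hA (mul_pos hμ hb)
      (by positivity)
    have hconst : κ * A ^ ((2 : ℝ) + 4 / d) = 2 * ((d : ℝ) / 4) ^ 2 /
        ((1 + (d : ℝ) / 4) * (1 + 2 * ((d : ℝ) / 4))) *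
        (A ^ 2 * (A / (μ * b)) ^ (1 / ((d : ℝ) / 4))) := by
      rw [one_div_div, Real.div_rpow hA (by positivity), Real.mul_rpow hμ.le hb.le, hbpow,
        Real.rpow_add' hA (by positivity), Real.rpow_two]
      simp only [κ]
      rw [neg_div, Real.rpow_neg hμ.le, Real.rpow_sub hd0, Real.rpow_two]
      have := Real.rpow_pos_of_pos hμ (4 / d)
      have := Real.rpow_pos_of_pos hd0 (2 / d)
      field_simp
      ring
    rw [hconst]
    refine h.trans (setLIntegral_mono' measurableSet_Ioi fun E hE => ?_)
    have hE0 : (0 : ℝ) < E := hE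
    gcongr
    rw [← ENNReal.ofReal_sub _ (by positivity)]
    have hs : √(1 + d * (2 * √(E / l)) ^ d) ≤ 1 + b * E ^ ((d : ℝ) / 4) := by
      rw [Real.sqrt_le_left (by positivity)]
      have h4 : (2 * √(E / l)) ^ d = ((4 / l) ^ ((d : ℝ) / 4) * E ^ ((d : ℝ) / 4)) ^ 2 := by
        rw [← Real.mul_rpow (by positivity) hE0.le, ← Real.rpow_two, ← Real.rpow_mul (by positivity),
          ← Real.rpow_natCast,
          show 4 / l * E = (2 * √(E / l)) ^ (2 : ℝ) by
            rw [Real.rpow_two, mul_pow, Real.sq_sqrt (by positivity)]; ring,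
          ← Real.rpow_mul (by positivity)]
        congr 1; ring
      have hsd : √(d : ℝ) ^ 2 = d := Real.sq_sqrt hd0.le
      have : (b * E ^ ((d : ℝ) / 4)) ^ 2 = d * (2 * √(E / l)) ^ d := by
        rw [h4]; simp only [b]; rw [← hsd]; simp only [Real.sqrt_sq (Real.sqrt_nonneg _)]; ring
      have : 0 ≤ b * E ^ ((d : ℝ) / 4) := by positivity
      nlinarith
    rcases le_total 0 (r - μ) with h | h
    · apply ENNReal.ofReal_le_ofReal
      have : A = r - μ := max_eq_right h
      rw [this]; nlinarith
    · have hA0 : A = 0 := max_eq_left h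
      rw [ENNReal.ofReal_of_nonpos (p := A - _)]
      · exact zero_le
      · rw [hA0]; have : 0 ≤ μ * b * E ^ ((d : ℝ) / 4) := by positivity
        linarith
  refine le_trans ?_ (add_le_add_left hinteg _)
  rw [← ENNReal.ofReal_add (by positivity) (by have : 0 < 1 - ε := by linarith
                                               positivity)]
  apply ENNReal.ofReal_le_ofReal
  rw [← mul_add]
  gcongr
  have h := rpow_mul_rpow_add_le (p := (2 : ℝ) + 4 / d) hA hμ.le
    (by have : (0 : ℝ) ≤ 4 / d := by positivity
        linarith) hε0 hε1
  rw [show (2 : ℝ) + 4 / d - 1 = 1 + 4 / d by ring] at h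
  refine le_trans ?_ h
  gcongr
  have : r - μ ≤ A := le_max_right _ _
  linarith

lemma eLpNorm_two_eq_lintegral_enorm_sq_rpow {α : Type*} [MeasurableSpace α] {μ : Measure α}
    (f : α → ℂ) : eLpNorm f 2 μ = (∫⁻ x, ‖f x‖ₑ ^ 2 ∂μ) ^ (1 / 2 : ℝ) := by
  rw [eLpNorm_eq_lintegral_rpow_enorm_toReal (by norm_num) (by norm_num)]
  simp

lemma enorm_sum_mul_sq_le {ι : Type*} (S : Finset ι) (a e : ι → ℂ) (he : ∀ m ∈ S, ‖e m‖ = 1) :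
    ‖∑ m ∈ S, a m * e m‖ₑ ^ 2 ≤ (S.card : ENNReal) * ∑ m ∈ S, ‖a m‖ₑ ^ 2 := by
  have h : ‖∑ m ∈ S, a m * e m‖ ^ 2 ≤ S.card * ∑ m ∈ S, ‖a m‖ ^ 2 := by
    refine le_trans ?_ sq_sum_le_card_mul_sum_sq
    gcongr
    refine (norm_sum_le _ _).trans (Finset.sum_le_sum fun m hm => ?_)
    rw [norm_mul, he m hm, mul_one]
  have h' := ENNReal.ofReal_le_ofReal h
  rw [ENNReal.ofReal_pow (norm_nonneg _), ofReal_norm,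
    ENNReal.ofReal_mul (Nat.cast_nonneg _), ENNReal.ofReal_natCast,
    ENNReal.ofReal_sum_of_nonneg (fun _ _ => sq_nonneg _)] at h'
  simpa only [ENNReal.ofReal_pow (norm_nonneg _), ofReal_norm] using h'

section Torus

open UnitAddTorus

attribute [local instance] instMeasureSpaceUnitAddCircle

lemma isProbabilityMeasure_volume_unitAddCircle :
    IsProbabilityMeasure (volume : Measure UnitAddCircle) :=
  inferInstanceAs (IsProbabilityMeasure AddCircle.haarAddCircle)

attribute [local instance] isProbabilityMeasure_volume_unitAddCircle

variable {d : ℕ}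

/-- **Parseval's identity** on the torus as an identity in `ℝ≥0∞`. -/
lemma tsum_enorm_mFourierCoeff_sq {f : UnitAddTorus (Fin d) → ℂ} (hf : MemLp f 2 volume) :
    ∑' m, ‖mFourierCoeff f m‖ₑ ^ 2 = ∫⁻ θ, ‖f θ‖ₑ ^ 2 := by
  have hcoe := hf.coeFn_toLp
  have hcoeff : ∀ m, mFourierCoeff (hf.toLp f) m = mFourierCoeff f m := fun m =>
    integral_congr_ae (by filter_upwards [hcoe] with θ hθ; rw [hθ])
  have hsum := hasSum_sq_mFourierCoeff (hf.toLp f)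
  simp_rw [hcoeff] at hsum
  have hinteg : ∫ θ, ‖(hf.toLp f) θ‖ ^ 2 = ∫ θ, ‖f θ‖ ^ 2 :=
    integral_congr_ae (by filter_upwards [hcoe] with θ hθ; rw [hθ])
  rw [hinteg] at hsum
  have h1 : ∀ z : ℂ, ‖z‖ₑ ^ 2 = ENNReal.ofReal (‖z‖ ^ 2) := fun z => by
    rw [ENNReal.ofReal_pow (norm_nonneg _), ofReal_norm]
  simp_rw [h1]
  rw [← ENNReal.ofReal_tsum_of_nonneg (fun _ => sq_nonneg _) hsum.summable, hsum.tsum_eq,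
    ofReal_integral_eq_lintegral_ofReal]
  · exact hf.norm.integrable_sq
  · exact Filter.Eventually.of_forall fun _ => sq_nonneg _

lemma norm_mFourier_apply (m : Fin d → ℤ) (θ : UnitAddTorus (Fin d)) : ‖mFourier m θ‖ = 1 := by
  simp only [mFourier, fourier_apply, ContinuousMap.coe_mk, norm_prod, Circle.norm_coe,
    Finset.prod_const_one]

lemma memLp_two_of_continuous {f : UnitAddTorus (Fin d) → ℂ} (hf : Continuous f) :
    MemLp f 2 (volume : Measure (UnitAddTorus (Fin d))) :=
  hf.memLp_of_hasCompactSupport (HasCompactSupport.of_compactSpace f)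

lemma integrable_mFourier_smul {f : UnitAddTorus (Fin d) → ℂ} (hf : MemLp f 2 volume)
    (m : Fin d → ℤ) : Integrable (fun θ => mFourier m θ • f θ) volume := by
  have hf1 : Integrable f volume := hf.integrable (by norm_num)
  refine hf1.bdd_mul (c := 1) (mFourier m).continuous.aestronglyMeasurable ?_
  exact Filter.Eventually.of_forall fun θ => (norm_mFourier_apply m θ).le

lemma mFourierCoeff_mFourier (m n : Fin d → ℤ) :
    mFourierCoeff (mFourier n) m = if m = n then 1 else 0 := by
  have h := orthonormal_iff_ite.mp (orthonormal_mFourier (d := Fin d)) m n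
  rw [← h, ContinuousMap.inner_toLp]
  simp only [mFourierCoeff, mFourier_neg, smul_eq_mul, mul_comm]

/-- Remainder of a partial Fourier sum in `L²`. -/
lemma lintegral_enorm_sub_partial_sum_sq {f : UnitAddTorus (Fin d) → ℂ} (hf : MemLp f 2 volume)
    (S : Finset (Fin d → ℤ)) :
    ∫⁻ θ, ‖f θ - ∑ m ∈ S, mFourierCoeff f m * mFourier m θ‖ₑ ^ 2 =
      ∑' m, if m ∈ S then 0 else ‖mFourierCoeff f m‖ₑ ^ 2 := by
  have hP : MemLp (fun θ => ∑ m ∈ S, mFourierCoeff f m * mFourier m θ) 2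
      (volume : Measure (UnitAddTorus (Fin d))) := memLp_two_of_continuous (by fun_prop)
  refine (tsum_enorm_mFourierCoeff_sq (hf.sub hP)).symm.trans ?_
  congr 1
  funext n
  have hsub : mFourierCoeff (f - fun θ => ∑ m ∈ S, mFourierCoeff f m * mFourier m θ) n =
      mFourierCoeff f n - if n ∈ S then mFourierCoeff f n else 0 := by
    have e : mFourierCoeff (f - fun θ => ∑ m ∈ S, mFourierCoeff f m * mFourier m θ) n =
        mFourierCoeff f n - mFourierCoeff (fun θ => ∑ m ∈ S, mFourierCoeff f m * mFourier m θ) n := by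
      rw [mFourierCoeff, mFourierCoeff, mFourierCoeff, ← integral_sub
        (integrable_mFourier_smul hf _) (integrable_mFourier_smul hP _)]
      simp [mul_sub]
    rw [e]
    congr 1
    have e2 : mFourierCoeff (fun θ => ∑ m ∈ S, mFourierCoeff f m * mFourier m θ) n =
        ∑ m ∈ S, mFourierCoeff f m * mFourierCoeff (mFourier m) n := by
      simp only [mFourierCoeff, smul_eq_mul]
      rw [← Finset.sum_congr rfl (fun m _ => integral_const_mul _ _), ← integral_finsetSum]
      · congr 1; funext θ; rw [Finset.mul_sum]; exact Finset.sum_congr rfl fun m _ => by ring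
      · intro m _
        exact (integrable_mFourier_smul (memLp_two_of_continuous (mFourier m).continuous)
          _).const_mul _
    rw [e2]
    simp [mFourierCoeff_mFourier]
  rw [hsub]
  split_ifs <;> simp

variable {Ω : Type*} [MeasurableSpace Ω] {ν : Measure Ω} [SFinite ν]

lemma stronglyMeasurable_mFourierCoeff {G : Ω → UnitAddTorus (Fin d) → ℂ}
    (hG : StronglyMeasurable (Function.uncurry G)) (m : Fin d → ℤ) :
    StronglyMeasurable fun ω => mFourierCoeff (G ω) m := by
  apply StronglyMeasurable.integral_prod_right (f := fun ω θ => mFourier (-m) θ • G ω θ)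
  exact ((mFourier (-m)).continuous.stronglyMeasurable.comp_measurable measurable_snd).smul hG

/-- High-frequency mass is bounded below by the excess of the density over its low-frequency
bound. -/
lemma lintegral_tsub_sq_le_high_frequency {G : Ω → UnitAddTorus (Fin d) → ℂ}
    (hG : StronglyMeasurable (Function.uncurry G)) (hG2 : ∀ ω, MemLp (G ω) 2 volume)
    (S : Finset (Fin d → ℤ)) :
    ∫⁻ θ, ((∫⁻ ω, ‖G ω θ‖ₑ ^ 2 ∂ν) ^ (1 / 2 : ℝ) -
        (S.card * ∫⁻ θ, ∫⁻ ω, ‖G ω θ‖ₑ ^ 2 ∂ν) ^ (1 / 2 : ℝ)) ^ 2 ≤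
      ∫⁻ ω, ∑' m, (if m ∈ S then 0 else ‖mFourierCoeff (G ω) m‖ₑ ^ 2) ∂ν := by
  set P : Ω → UnitAddTorus (Fin d) → ℂ := fun ω θ => ∑ m ∈ S, mFourierCoeff (G ω) m * mFourier m θ
  have hP : StronglyMeasurable (Function.uncurry P) := by
    apply Finset.stronglyMeasurable_fun_sum
    intro m _
    exact ((stronglyMeasurable_mFourierCoeff hG m).comp_measurable measurable_fst).mul
      ((mFourier m).continuous.stronglyMeasurable.comp_measurable measurable_snd)
  have hsq : ∀ {F : Ω → UnitAddTorus (Fin d) → ℂ}, StronglyMeasurable (Function.uncurry F) →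
      AEMeasurable (Function.uncurry fun ω θ => ‖F ω θ‖ₑ ^ 2) (ν.prod volume) := fun hF =>
    (hF.enorm.pow_const 2).aemeasurable
  simp_rw [← fun ω => lintegral_enorm_sub_partial_sum_sq (hG2 ω) S]
  change _ ≤ ∫⁻ ω, ∫⁻ θ, ‖G ω θ - P ω θ‖ₑ ^ 2 ∂volume ∂ν
  have hGP : StronglyMeasurable (Function.uncurry fun ω θ => G ω θ - P ω θ) := hG.sub hP
  rw [lintegral_lintegral_swap (hsq hGP), ← lintegral_lintegral_swap (hsq hG)]
  refine lintegral_mono fun θ => ?_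
  have hGθ : StronglyMeasurable fun ω => G ω θ := hG.comp_measurable measurable_prodMk_right
  have hPθ : StronglyMeasurable fun ω => P ω θ := hP.comp_measurable measurable_prodMk_right
  have htri : (∫⁻ ω, ‖G ω θ‖ₑ ^ 2 ∂ν) ^ (1 / 2 : ℝ) ≤
      (∫⁻ ω, ‖G ω θ - P ω θ‖ₑ ^ 2 ∂ν) ^ (1 / 2 : ℝ) + (∫⁻ ω, ‖P ω θ‖ₑ ^ 2 ∂ν) ^ (1 / 2 : ℝ) := by
    have h := eLpNorm_add_le (μ := ν) (p := 2) (hGθ.sub hPθ).aestronglyMeasurable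
      hPθ.aestronglyMeasurable (by norm_num)
    rw [sub_add_cancel] at h
    simpa only [eLpNorm_two_eq_lintegral_enorm_sq_rpow, Pi.sub_apply] using h
  have hlow : ∫⁻ ω, ‖P ω θ‖ₑ ^ 2 ∂ν ≤ S.card * ∫⁻ ω, (∫⁻ θ, ‖G ω θ‖ₑ ^ 2) ∂ν := by
    rw [← lintegral_const_mul']
    · refine lintegral_mono fun ω => (enorm_sum_mul_sq_le S _ _
        fun m _ => norm_mFourier_apply m θ).trans ?_
      gcongr
      rw [← tsum_enorm_mFourierCoeff_sq (hG2 ω)]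
      exact ENNReal.sum_le_tsum S
    · exact ENNReal.natCast_ne_top _
  calc _ ≤ ((∫⁻ ω, ‖G ω θ - P ω θ‖ₑ ^ 2 ∂ν) ^ (1 / 2 : ℝ)) ^ 2 := by
        gcongr
        rw [tsub_le_iff_right]
        refine htri.trans ?_
        gcongr
    _ = _ := by
      rw [← ENNReal.rpow_natCast, ← ENNReal.rpow_mul]
      norm_num

end Torus

lemma exists_finset_lattice_ball {d : ℕ} (hd : 1 ≤ d) {x : ℝ} (hx : 0 ≤ x) :
    ∃ S : Finset (Fin d → ℤ), (∀ m, m ∈ S ↔ ∑ i, (m i : ℝ) ^ 2 ≤ x) ∧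
      (S.card : ℝ) ≤ 1 + d * (2 * √x) ^ d := by
  have hfl : ∀ m : Fin d → ℤ, ∑ i, (m i : ℝ) ^ 2 ≤ x ↔ ∑ i, (m i) ^ 2 ≤ (⌊x⌋₊ : ℤ) := by
    intro m
    rw [Int.natCast_floor_eq_floor hx, Int.le_floor]
    push_cast
    rfl
  set S : Finset (Fin d → ℤ) :=
    (Fintype.piFinset fun _ => Finset.Icc (-(⌊x⌋₊ : ℤ)) ⌊x⌋₊).filter
      fun m => ∑ i, (m i) ^ 2 ≤ (⌊x⌋₊ : ℤ) with hS
  refine ⟨S, fun m => ?_, ?_⟩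
  · rw [hfl, hS, Finset.mem_filter, Fintype.mem_piFinset]
    refine ⟨fun h => h.2, fun h => ⟨fun i => ?_, h⟩⟩
    have hi : (m i) ^ 2 ≤ (⌊x⌋₊ : ℤ) :=
      (Finset.single_le_sum (f := fun i => (m i) ^ 2) (fun _ _ => sq_nonneg _)
        (Finset.mem_univ i)).trans h
    rw [Finset.mem_Icc, ← abs_le]
    exact (Int.le_self_sq _).trans (by rwa [sq_abs])
  · refine (card_lattice_le hd fun m hm => (Finset.mem_filter.mp hm).2).trans ?_
    gcongr
    exact Nat.floor_le hx

lemma ofReal_mul_eq_lintegral_indicator (b : ℝ) (a : ENNReal) :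
    ENNReal.ofReal b * a = ∫⁻ E in Set.Ioi (0 : ℝ), if b ≤ E then 0 else a := by
  have h : ∀ E : ℝ, (if b ≤ E then 0 else a) = (Set.Iio b).indicator (fun _ => a) E := by
    intro E
    by_cases hE : b ≤ E <;> simp [Set.indicator, hE]
  simp_rw [h]
  rw [lintegral_indicator measurableSet_Iio, lintegral_const, Measure.restrict_restrict
    measurableSet_Iio, Measure.restrict_apply_univ, Set.Iio_inter_Ioi, Real.volume_Ioo,
    sub_zero, mul_comm]

section Torus

open UnitAddTorus

attribute [local instance] instMeasureSpaceUnitAddCircle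

attribute [local instance] isProbabilityMeasure_volume_unitAddCircle

variable {d : ℕ} {Ω : Type*} [MeasurableSpace Ω] {ν : Measure Ω} [SFinite ν]

/-- Layer-cake decomposition of the kinetic energy in frequency space. -/
lemma lintegral_tsum_frequency_eq {G : Ω → UnitAddTorus (Fin d) → ℂ}
    (hG : StronglyMeasurable (Function.uncurry G)) (l : ℝ) :
    ∫⁻ ω, ∑' m : Fin d → ℤ,
        ENNReal.ofReal (l * ∑ i, (m i : ℝ) ^ 2) * ‖mFourierCoeff (G ω) m‖ₑ ^ 2 ∂ν =
      ∫⁻ E in Set.Ioi (0 : ℝ), ∫⁻ ω, ∑' m : Fin d → ℤ,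
        (if l * ∑ i, (m i : ℝ) ^ 2 ≤ E then 0 else ‖mFourierCoeff (G ω) m‖ₑ ^ 2) ∂ν := by
  have hmeas : ∀ m : Fin d → ℤ, Measurable (Function.uncurry fun (ω : Ω) (E : ℝ) =>
      if l * ∑ i, (m i : ℝ) ^ 2 ≤ E then 0 else ‖mFourierCoeff (G ω) m‖ₑ ^ 2) := by
    intro m
    have hm : Measurable fun p : Ω × ℝ => ‖mFourierCoeff (G p.1) m‖ₑ ^ 2 :=
      ((stronglyMeasurable_mFourierCoeff hG m).measurable.enorm.pow_const 2).comp measurable_fst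
    exact Measurable.ite (measurableSet_le measurable_const measurable_snd) measurable_const hm
  simp_rw [ofReal_mul_eq_lintegral_indicator]
  rw [← lintegral_lintegral_swap]
  · refine lintegral_congr fun ω => ?_
    rw [lintegral_tsum]
    exact fun m => ((hmeas m).comp measurable_prodMk_left).aemeasurable
  · exact (Measurable.tsum hmeas).aemeasurable

/-- Kinetic energy inequality of Lieb–Thirring type on the torus. -/
theorem torus_kinetic_lower_bound (hd : 1 ≤ d) {G : Ω → UnitAddTorus (Fin d) → ℂ}
    (hG : StronglyMeasurable (Function.uncurry G)) (hG2 : ∀ ω, MemLp (G ω) 2 volume)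
    {M : ℝ} (hM : 0 < M) (hGM : ∫⁻ θ, ∫⁻ ω, ‖G ω θ‖ₑ ^ 2 ∂ν = ENNReal.ofReal M)
    {l ε : ℝ} (hl : 0 < l) (hε0 : 0 < ε) (hε1 : ε < 1) :
    ENNReal.ofReal (l / 4 * (d : ℝ) ^ ((2 : ℝ) - 2 / d) / ((d + 2) * (d + 4)) *
        M ^ (-(2 : ℝ) / d) * ε ^ ((1 : ℝ) + 4 / d)) *
        ∫⁻ θ, (∫⁻ ω, ‖G ω θ‖ₑ ^ 2 ∂ν) ^ ((1 : ℝ) + 2 / d) ≤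
      ∫⁻ ω, ∑' m : Fin d → ℤ,
        ENNReal.ofReal (l * ∑ i, (m i : ℝ) ^ 2) * ‖mFourierCoeff (G ω) m‖ₑ ^ 2 ∂ν +
      ENNReal.ofReal (l / 4 * (d : ℝ) ^ ((2 : ℝ) - 2 / d) / ((d + 2) * (d + 4)) *
        (ε / (1 - ε)) ^ ((1 : ℝ) + 4 / d) * M) := by
  have hd' : (0 : ℝ) < d := by exact_mod_cast hd
  set κ : ℝ := l / 4 * (d : ℝ) ^ ((2 : ℝ) - 2 / d) / ((d + 2) * (d + 4)) with hκ
  have hκ0 : 0 < κ := by positivity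
  set ρ : UnitAddTorus (Fin d) → ENNReal := fun θ => ∫⁻ ω, ‖G ω θ‖ₑ ^ 2 ∂ν with hρ
  have hρm : Measurable ρ := by
    apply Measurable.lintegral_prod_left' (f := fun p : Ω × UnitAddTorus (Fin d) => ‖G p.1 p.2‖ₑ ^ 2)
    exact hG.enorm.pow_const 2
  have hρfin : ∀ᵐ θ, ρ θ < ⊤ := ae_lt_top hρm (by rw [hGM]; exact ENNReal.ofReal_ne_top)
  set b : ℝ → ENNReal := fun E => ENNReal.ofReal (√M * √(1 + d * (2 * √(E / l)) ^ d)) with hb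
  have hbm : Measurable b := by fun_prop
  have hlow : ∫⁻ θ, ∫⁻ E in Set.Ioi (0 : ℝ), (ρ θ ^ (1 / 2 : ℝ) - b E) ^ 2 ≤
      ∫⁻ ω, ∑' m : Fin d → ℤ,
        ENNReal.ofReal (l * ∑ i, (m i : ℝ) ^ 2) * ‖mFourierCoeff (G ω) m‖ₑ ^ 2 ∂ν := by
    rw [lintegral_tsum_frequency_eq hG, lintegral_lintegral_swap]
    · refine setLIntegral_mono' measurableSet_Ioi fun E hE => ?_
      obtain ⟨S, hS, hcard⟩ := exists_finset_lattice_ball hd (div_nonneg (le_of_lt hE) hl.le)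
      have hS' : ∀ m : Fin d → ℤ, l * ∑ i, (m i : ℝ) ^ 2 ≤ E ↔ m ∈ S := fun m => by
        rw [hS, le_div_iff₀' hl]
      simp_rw [hS']
      refine le_trans ?_ (lintegral_tsub_sq_le_high_frequency hG hG2 S)
      refine lintegral_mono fun θ => ?_
      gcongr
      rw [hGM]
      simp only [hb]
      rw [← Real.sqrt_mul hM.le, Real.sqrt_eq_rpow,
        ← ENNReal.ofReal_rpow_of_nonneg (by positivity) (by norm_num), mul_comm M,
        ENNReal.ofReal_mul (by positivity)]
      gcongr
      rw [← ENNReal.ofReal_natCast]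
      exact ENNReal.ofReal_le_ofReal hcard
    · apply Measurable.aemeasurable
      exact (((hρm.pow_const _).comp measurable_fst).sub (hbm.comp measurable_snd)).pow_const 2
  have hpt : ∀ᵐ θ, ENNReal.ofReal (κ * M ^ (-(2 : ℝ) / d) * ε ^ ((1 : ℝ) + 4 / d)) *
      ρ θ ^ ((1 : ℝ) + 2 / d) ≤ (∫⁻ E in Set.Ioi (0 : ℝ), (ρ θ ^ (1 / 2 : ℝ) - b E) ^ 2) +
        ENNReal.ofReal (κ * (ε / (1 - ε)) ^ ((1 : ℝ) + 4 / d) * M) := by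
    filter_upwards [hρfin] with θ hθ
    have hr0 : 0 ≤ (ρ θ).toReal := ENNReal.toReal_nonneg
    have hr : ρ θ = ENNReal.ofReal (ρ θ).toReal := (ENNReal.ofReal_toReal hθ.ne).symm
    have h := ofReal_le_lintegral_tsub_sqrt_sq hd (Real.sqrt_nonneg (ρ θ).toReal)
      (Real.sqrt_pos.mpr hM) hl hε0 hε1
    have e1 : ρ θ ^ (1 / 2 : ℝ) = ENNReal.ofReal √(ρ θ).toReal := by
      rw [Real.sqrt_eq_rpow, ← ENNReal.ofReal_rpow_of_nonneg hr0 (by norm_num), ← hr]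
    have e2 : (√M) ^ (-(4 : ℝ) / d) = M ^ (-(2 : ℝ) / d) := by
      rw [Real.sqrt_eq_rpow, ← Real.rpow_mul hM.le]; congr 1; ring
    have e3 : (√(ρ θ).toReal) ^ ((2 : ℝ) + 4 / d) = (ρ θ).toReal ^ ((1 : ℝ) + 2 / d) := by
      rw [Real.sqrt_eq_rpow, ← Real.rpow_mul hr0]; congr 1; ring
    have e4 : (√M) ^ ((2 : ℝ) + 4 / d) = M * M ^ ((2 : ℝ) / d) := by
      rw [Real.sqrt_eq_rpow, ← Real.rpow_mul hM.le, ← Real.rpow_one_add' hM.le (by positivity)]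
      congr 1; ring
    have e5 : M ^ (-(2 : ℝ) / d) * M ^ ((2 : ℝ) / d) = 1 := by
      rw [← Real.rpow_add hM, neg_div, neg_add_cancel, Real.rpow_zero]
    rw [← hκ, e2, e3, e4, ← e1] at h
    refine le_trans (le_of_eq ?_) (h.trans (le_of_eq ?_))
    · conv_lhs => rw [hr, ENNReal.ofReal_rpow_of_nonneg hr0 (by positivity)]
      rw [← ENNReal.ofReal_mul (by positivity)]
      congr 1; ring
    · congr 2
      linear_combination (κ * (ε / (1 - ε)) ^ ((1 : ℝ) + 4 / d) * M) * e5
  rw [← lintegral_const_mul' _ _ ENNReal.ofReal_ne_top]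
  refine (lintegral_mono_ae hpt).trans ?_
  rw [lintegral_add_right _ measurable_const, lintegral_const, measure_univ, mul_one]
  gcongr

end Torus

/-- The sign of the representative in `(-1/2, 1/2]` of a point of the circle, with value `1`
at `0`. -/
noncomputable def circleSign (θ : UnitAddCircle) : ℝ :=
  if 0 ≤ (fourier 1 θ).im then 1 else -1

lemma measurable_circleSign : Measurable circleSign := by
  refine Measurable.ite (measurableSet_le measurable_const ?_) measurable_const measurable_const
  exact (Complex.continuous_im.comp (fourier 1).continuous).measurable

lemma abs_circleSign (θ : UnitAddCircle) : |circleSign θ| = 1 := by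
  unfold circleSign
  split_ifs <;> simp

lemma circleSign_coe {t : ℝ} (ht : t ∈ Set.Ioc (-1 / 2 : ℝ) (1 / 2)) :
    circleSign (t : UnitAddCircle) = if 0 ≤ t then 1 else -1 := by
  have him : (fourier 1 (t : UnitAddCircle)).im = Real.sin (2 * Real.pi * t) := by
    rw [fourier_coe_apply, show (2 * Real.pi * Complex.I * (1 : ℤ) * t / (1 : ℝ) : ℂ) =
      ((2 * Real.pi * t : ℝ) : ℂ) * Complex.I by push_cast; ring, Complex.exp_ofReal_mul_I_im]
  have hpi := Real.pi_pos
  rw [circleSign, him]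
  congr 1
  refine propext ⟨fun h => ?_, fun h => ?_⟩
  · by_contra! h0
    refine absurd h (not_le.mpr (Real.sin_neg_of_neg_of_neg_pi_lt ?_ ?_)) <;> nlinarith [ht.1]
  · exact Real.sin_nonneg_of_nonneg_of_le_pi (by positivity) (by nlinarith [ht.2])

lemma norm_coe_unitAddCircle {t : ℝ} (ht : |t| ≤ 1 / 2) : ‖(t : UnitAddCircle)‖ = |t| :=
  (AddCircle.norm_coe_eq_abs_iff 1 one_ne_zero).mpr (by simpa using ht)

/-- Fourier coefficients of the derivative of the even reflection of a function. -/
lemma fourierCoeff_deriv_reflection {f f' : ℝ → ℂ} (hf : ∀ x, HasDerivAt f (f' x) x)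
    (hf' : Continuous f') (c s : ℝ) (n : ℤ) :
    fourierCoeff (fun θ : UnitAddCircle => (2 * s * circleSign θ : ℝ) • f' (c + 2 * s * ‖θ‖)) n =
      2 * Real.pi * Complex.I * n *
        fourierCoeff (fun θ : UnitAddCircle => f (c + 2 * s * ‖θ‖)) n := by
  have hfc : Continuous f := continuous_iff_continuousAt.mpr fun x => (hf x).continuousAt
  have hab : (-1 / 2 : ℝ) + 1 = 1 / 2 := by norm_num
  have hle : (-1 / 2 : ℝ) ≤ 1 / 2 := by norm_num
  set v' : ℝ → ℂ := fun t => (2 * s * (if 0 ≤ t then 1 else -1) : ℝ) • f' (c + 2 * s * |t|)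
  have hder : ∀ t : ℝ, HasDerivWithinAt (fun t => f (c + 2 * s * |t|)) (v' t) (Set.Ioi t) t := by
    intro t
    have habs : HasDerivWithinAt (fun t : ℝ => |t|) (if 0 ≤ t then 1 else -1) (Set.Ioi t) t := by
      split_ifs with h
      · refine (hasDerivWithinAt_id t _).congr (fun x hx => ?_) (abs_of_nonneg h)
        exact abs_of_pos (lt_of_le_of_lt h hx)
      · exact (hasDerivAt_abs_neg (not_le.mp h)).hasDerivWithinAt
    exact (hf _).scomp_hasDerivWithinAt t ((habs.const_mul (2 * s)).const_add c)
  have hcont : Continuous fun t : ℝ => fourier (-n) (t : UnitAddCircle) :=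
    (fourier (-n)).continuous.comp (AddCircle.continuous_mk' 1)
  have hv' : IntervalIntegrable v' volume (-1 / 2) (1 / 2) := by
    have hc : IntervalIntegrable (fun t => f' (c + 2 * s * |t|)) volume (-1 / 2) (1 / 2) :=
      (by fun_prop : Continuous fun t => f' (c + 2 * s * |t|)).intervalIntegrable _ _
    rw [intervalIntegrable_iff] at hc ⊢
    refine Integrable.bdd_smul (𝕜 := ℝ) hc |2 * s| ?_ ?_
    · apply Measurable.aestronglyMeasurable
      exact measurable_const.mul
        (Measurable.ite measurableSet_Ici measurable_const measurable_const)
    · refine Filter.Eventually.of_forall fun t => ?_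
      change |2 * s * (if 0 ≤ t then (1 : ℝ) else -1)| ≤ _
      split_ifs <;> simp
  have hIBP := intervalIntegral.integral_mul_deriv_eq_deriv_mul_of_hasDeriv_right
    (a := -1 / 2) (b := 1 / 2) (u := fun t : ℝ => fourier (-n) (t : UnitAddCircle))
    (v := fun t => f (c + 2 * s * |t|)) (v' := v')
    (u' := fun t : ℝ => -2 * Real.pi * Complex.I * n / (1 : ℝ) * fourier (-n) (t : UnitAddCircle))
    hcont.continuousOn (by fun_prop)
    (fun t _ => (hasDerivAt_fourier_neg 1 n t).hasDerivWithinAt) (fun t _ => hder t)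
    ((hcont.const_mul _).intervalIntegrable _ _) hv'
  have hend : ((1 / 2 : ℝ) : UnitAddCircle) = ((-1 / 2 : ℝ) : UnitAddCircle) := by
    rw [← hab, AddCircle.coe_add, AddCircle.coe_period, add_zero]
  have habs : |(1 / 2 : ℝ)| = |(-1 / 2 : ℝ)| := by norm_num
  rw [hend, habs, sub_self, zero_sub] at hIBP
  have hmem : ∀ t ∈ Set.uIoc (-1 / 2 : ℝ) (1 / 2), |t| ≤ 1 / 2 := fun t ht => by
    rw [Set.uIoc_of_le hle] at ht
    exact abs_le.mpr ⟨by linarith [ht.1], ht.2⟩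
  rw [fourierCoeff_eq_intervalIntegral _ n (-1 / 2), fourierCoeff_eq_intervalIntegral _ n (-1 / 2),
    hab]
  have e1 : ∫ t in (-1 / 2 : ℝ)..1 / 2, fourier (-n) (t : UnitAddCircle) •
      ((2 * s * circleSign t : ℝ) • f' (c + 2 * s * ‖(t : UnitAddCircle)‖)) =
      ∫ t in (-1 / 2 : ℝ)..1 / 2, fourier (-n) (t : UnitAddCircle) * v' t := by
    refine intervalIntegral.integral_congr_ae (Filter.Eventually.of_forall fun t ht => ?_)
    rw [norm_coe_unitAddCircle (hmem t ht), circleSign_coe (by rwa [Set.uIoc_of_le hle] at ht),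
      smul_eq_mul]
  have e2 : ∫ t in (-1 / 2 : ℝ)..1 / 2, fourier (-n) (t : UnitAddCircle) •
      f (c + 2 * s * ‖(t : UnitAddCircle)‖) =
      ∫ t in (-1 / 2 : ℝ)..1 / 2, fourier (-n) (t : UnitAddCircle) * f (c + 2 * s * |t|) := by
    refine intervalIntegral.integral_congr_ae (Filter.Eventually.of_forall fun t ht => ?_)
    rw [norm_coe_unitAddCircle (hmem t ht), smul_eq_mul]
  rw [e1, e2, hIBP]
  simp_rw [mul_assoc _ (fourier (-n) _) _]
  rw [intervalIntegral.integral_const_mul]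
  simp

/-- The folding map from the torus onto the cube with corner `c` and side `s`. -/
noncomputable def torusFold {d : ℕ} (c : EuclideanSpace ℝ (Fin d)) (s : ℝ)
    (θ : UnitAddTorus (Fin d)) : EuclideanSpace ℝ (Fin d) :=
  WithLp.toLp 2 fun i => c i + 2 * s * ‖θ i‖

lemma continuous_torusFold {d : ℕ} (c : EuclideanSpace ℝ (Fin d)) (s : ℝ) :
    Continuous (torusFold c s) := by
  unfold torusFold
  fun_prop

lemma torusFold_insertNth {k : ℕ} (c : EuclideanSpace ℝ (Fin (k + 1))) (s : ℝ) (i : Fin (k + 1))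
    (t : UnitAddCircle) (z : Fin k → UnitAddCircle) :
    torusFold c s (i.insertNth t z) =
      WithLp.toLp 2 (i.insertNth 0 fun j => c (i.succAbove j) + 2 * s * ‖z j‖) +
        (c i + 2 * s * ‖t‖) • EuclideanSpace.single i (1 : ℝ) := by
  ext j
  refine Fin.succAboveCases i ?_ (fun j => ?_) j <;> simp [torusFold]

section Torus

open UnitAddTorus

attribute [local instance] instMeasureSpaceUnitAddCircle

attribute [local instance] isProbabilityMeasure_volume_unitAddCircle

/-- A Fourier coefficient on the torus as an iterated integral, with the `i`-th variable
integrated first. -/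
lemma mFourierCoeff_eq_integral_fourierCoeff {k : ℕ} {g : UnitAddTorus (Fin (k + 1)) → ℂ}
    (hg : MemLp g 2 volume) (m : Fin (k + 1) → ℤ) (i : Fin (k + 1)) :
    mFourierCoeff g m = ∫ z : Fin k → UnitAddCircle,
      (∏ j, fourier (-m (i.succAbove j)) (z j)) *
        fourierCoeff (fun t => g (i.insertNth t z)) (m i) := by
  have hmp := (volume_preserving_piFinSuccAbove (fun _ => UnitAddCircle) i).symm
  have hinteg := integrable_mFourier_smul hg (-m)
  rw [mFourierCoeff, ← hmp.integral_comp (MeasurableEquiv.measurableEmbedding _)]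
  have hinteg' := (hmp.integrable_comp_emb (MeasurableEquiv.measurableEmbedding _)).mpr hinteg
  rw [Measure.volume_eq_prod] at hinteg' ⊢
  refine (integral_prod_symm _ hinteg').trans ?_
  refine integral_congr_ae (Filter.Eventually.of_forall fun z => ?_)
  simp only [fourierCoeff]
  rw [← integral_const_mul]
  refine integral_congr_ae (Filter.Eventually.of_forall fun t => ?_)
  simp only [MeasurableEquiv.piFinSuccAbove_symm_apply, Fin.insertNthEquiv, Equiv.coe_fn_mk,
    mFourier, ContinuousMap.coe_mk, Fin.prod_univ_succAbove _ i, Fin.insertNth_apply_same,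
    Fin.insertNth_apply_succAbove, smul_eq_mul, Pi.neg_apply, Function.comp_apply]
  ring

variable {d : ℕ}

lemma memLp_circleSign_smul {g : UnitAddTorus (Fin d) → ℂ} (hg : Continuous g) (s : ℝ)
    (i : Fin d) :
    MemLp (fun θ => (2 * s * circleSign (θ i) : ℝ) • g θ) 2
      (volume : Measure (UnitAddTorus (Fin d))) := by
  refine (memLp_two_of_continuous hg).of_le_mul (c := |2 * s|) ?_ ?_
  · exact (measurable_const.mul (measurable_circleSign.comp
      (measurable_pi_apply i))).aestronglyMeasurable.smul hg.aestronglyMeasurable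
  · refine Filter.Eventually.of_forall fun θ => ?_
    rw [norm_smul, Real.norm_eq_abs, abs_mul, abs_circleSign, mul_one]

/-- Fourier coefficients of the derivative of the even reflection of a function on a cube. -/
lemma mFourierCoeff_deriv_reflection {f : EuclideanSpace ℝ (Fin d) → ℂ} (hf : ContDiff ℝ 1 f)
    (c : EuclideanSpace ℝ (Fin d)) (s : ℝ) (m : Fin d → ℤ) (i : Fin d) :
    mFourierCoeff (fun θ => (2 * s * circleSign (θ i) : ℝ) •
        fderiv ℝ f (torusFold c s θ) (EuclideanSpace.single i 1)) m =
      2 * Real.pi * Complex.I * m i * mFourierCoeff (fun θ => f (torusFold c s θ)) m := by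
  obtain _ | k := d
  · exact i.elim0
  have hf' : Continuous fun x => fderiv ℝ f x (EuclideanSpace.single i 1) :=
    (hf.continuous_fderiv one_ne_zero).clm_apply continuous_const
  have hfold := continuous_torusFold c s
  rw [mFourierCoeff_eq_integral_fourierCoeff
      (memLp_circleSign_smul (g := fun θ => fderiv ℝ f (torusFold c s θ)
        (EuclideanSpace.single i 1)) (hf'.comp hfold) s i) m i,
    mFourierCoeff_eq_integral_fourierCoeff
      (memLp_two_of_continuous (f := fun θ => f (torusFold c s θ))
        (hf.continuous.comp hfold)) m i, ← integral_const_mul]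
  refine integral_congr_ae (Filter.Eventually.of_forall fun z => ?_)
  simp only [torusFold_insertNth, Fin.insertNth_apply_same]
  set b : EuclideanSpace ℝ (Fin (k + 1)) :=
    WithLp.toLp 2 (i.insertNth 0 fun j => c (i.succAbove j) + 2 * s * ‖z j‖)
  have hder : ∀ x : ℝ, HasDerivAt (fun x : ℝ => f (b + x • EuclideanSpace.single i (1 : ℝ)))
      (fderiv ℝ f (b + x • EuclideanSpace.single i (1 : ℝ)) (EuclideanSpace.single i 1)) x := by
    intro x
    have h1 : HasDerivAt (fun x : ℝ => b + x • EuclideanSpace.single i (1 : ℝ))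
        (EuclideanSpace.single i (1 : ℝ)) x := by
      simpa using ((hasDerivAt_id x).smul_const (EuclideanSpace.single i (1 : ℝ))).const_add b
    exact ((hf.differentiable one_ne_zero) _).hasFDerivAt.comp_hasDerivAt x h1
  rw [fourierCoeff_deriv_reflection hder (hf'.comp (by fun_prop))]
  ring

/-- The Dirichlet energy of a function on a cube in terms of the Fourier coefficients of its
even reflection. -/
lemma tsum_frequency_eq_lintegral_fderiv {f : EuclideanSpace ℝ (Fin d) → ℂ} (hf : ContDiff ℝ 1 f)
    (c : EuclideanSpace ℝ (Fin d)) {s : ℝ} (hs : 0 < s) :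
    ∑' m : Fin d → ℤ, ENNReal.ofReal (Real.pi ^ 2 / s ^ 2 * ∑ i, (m i : ℝ) ^ 2) *
        ‖mFourierCoeff (fun θ => f (torusFold c s θ)) m‖ₑ ^ 2 =
      ∫⁻ θ, ∑ i, ‖fderiv ℝ f (torusFold c s θ) (EuclideanSpace.single i 1)‖ₑ ^ 2 := by
  have hf' : ∀ i, Continuous fun θ => fderiv ℝ f (torusFold c s θ) (EuclideanSpace.single i 1) :=
    fun i => ((hf.continuous_fderiv one_ne_zero).comp (continuous_torusFold c s)).clm_apply
      continuous_const
  have hs0 : ENNReal.ofReal (4 * s ^ 2) ≠ 0 := by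
    rw [ne_eq, ENNReal.ofReal_eq_zero, not_le]; positivity
  have hnorm : ∀ i, ∑' m : Fin d → ℤ, ENNReal.ofReal (Real.pi ^ 2 / s ^ 2 * (m i : ℝ) ^ 2) *
      ‖mFourierCoeff (fun θ => f (torusFold c s θ)) m‖ₑ ^ 2 =
      ∫⁻ θ, ‖fderiv ℝ f (torusFold c s θ) (EuclideanSpace.single i 1)‖ₑ ^ 2 := by
    intro i
    have h := tsum_enorm_mFourierCoeff_sq (memLp_circleSign_smul (hf' i) s i)
    simp_rw [mFourierCoeff_deriv_reflection hf c s _ i] at h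
    have e1 : ∀ m : Fin d → ℤ, ‖2 * Real.pi * Complex.I * m i *
        mFourierCoeff (fun θ => f (torusFold c s θ)) m‖ₑ ^ 2 =
        ENNReal.ofReal (4 * s ^ 2) * (ENNReal.ofReal (Real.pi ^ 2 / s ^ 2 * (m i : ℝ) ^ 2) *
          ‖mFourierCoeff (fun θ => f (torusFold c s θ)) m‖ₑ ^ 2) := by
      intro m
      rw [enorm_mul, mul_pow, ← mul_assoc, ← ENNReal.ofReal_mul (by positivity), ← ofReal_norm,
        ← ENNReal.ofReal_pow (norm_nonneg _)]
      congr 2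
      simp only [norm_mul, Complex.norm_I, Complex.norm_real, Complex.norm_intCast,
        Complex.norm_ofNat, mul_pow, Real.norm_eq_abs, sq_abs]
      field_simp
      ring
    have e2 : ∀ θ : UnitAddTorus (Fin d), ‖(2 * s * circleSign (θ i) : ℝ) •
        fderiv ℝ f (torusFold c s θ) (EuclideanSpace.single i 1)‖ₑ ^ 2 =
        ENNReal.ofReal (4 * s ^ 2) *
          ‖fderiv ℝ f (torusFold c s θ) (EuclideanSpace.single i 1)‖ₑ ^ 2 := by
      intro θ
      rw [enorm_smul, mul_pow, ← ofReal_norm (2 * s * circleSign (θ i)),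
        ← ENNReal.ofReal_pow (norm_nonneg _), Real.norm_eq_abs, abs_mul, abs_circleSign, mul_one,
        sq_abs]
      congr 2
      ring
    simp_rw [e1, e2] at h
    rw [ENNReal.tsum_mul_left, lintegral_const_mul' _ _ ENNReal.ofReal_ne_top] at h
    exact (ENNReal.mul_right_inj hs0 ENNReal.ofReal_ne_top).mp h
  rw [lintegral_finsetSum _ fun i _ => ((hf' i).enorm.measurable).pow_const 2]
  simp_rw [← hnorm]
  rw [← Summable.tsum_finsetSum fun _ _ => ENNReal.summable]
  refine tsum_congr fun m => ?_
  rw [← Finset.sum_mul, ← ENNReal.ofReal_sum_of_nonneg fun _ _ => by positivity, Finset.mul_sum]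

end Torus

lemma lintegral_comp_add_mul {c a p q p' q' : ℝ} (ha : a ≠ 0)
    (himage : (fun t => c + a * t) '' Set.Ioo p q = Set.Ioo p' q')
    (φ : ℝ → ENNReal) :
    ENNReal.ofReal |a| * ∫⁻ t in Set.Ioo p q, φ (c + a * t) = ∫⁻ y in Set.Icc p' q', φ y := by
  rw [← setLIntegral_congr Ioo_ae_eq_Icc, ← himage,
    lintegral_image_eq_lintegral_abs_deriv_mul (f := fun t => c + a * t) (f' := fun _ => a)
      measurableSet_Ioo _ _ φ, lintegral_const_mul' _ _ ENNReal.ofReal_ne_top]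
  · intro t _
    simpa using (((hasDerivAt_id t).const_mul a).const_add c).hasDerivWithinAt
  · intro x _ y _ h
    simpa [ha] using h

lemma image_add_mul_Ioo {c s : ℝ} (hs : 0 < s) :
    (fun t => c + 2 * s * t) '' Set.Ioo 0 (1 / 2) = Set.Ioo c (c + s) := by
  have h : (fun t => c + 2 * s * t) = (fun x => c + x) ∘ fun t => 2 * s * t := rfl
  rw [h, Set.image_comp, Set.image_mul_left_Ioo (by positivity), Set.image_const_add_Ioo]
  congr 1 <;> ring

lemma image_sub_mul_Ioo {c s : ℝ} (hs : 0 < s) :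
    (fun t => c + (-(2 * s)) * t) '' Set.Ioo (-1 / 2) 0 = Set.Ioo c (c + s) := by
  have h : (fun t => c + (-(2 * s)) * t) = (fun t => c + 2 * s * t) ∘ fun t => -t := by
    funext t; simp
  rw [h, Set.image_comp, Set.image_neg_Ioo, ← image_add_mul_Ioo hs]
  norm_num

lemma lintegral_haarAddCircle_comp_norm (c : ℝ) {s : ℝ} (hs : 0 < s) (φ : ℝ → ENNReal) :
    ∫⁻ θ : UnitAddCircle, φ (c + 2 * s * ‖θ‖) ∂AddCircle.haarAddCircle =
      ENNReal.ofReal s⁻¹ * ∫⁻ y in Set.Icc c (c + s), φ y := by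
  have hvol : (AddCircle.haarAddCircle : Measure UnitAddCircle) = volume := by
    rw [AddCircle.volume_eq_smul_haarAddCircle, ENNReal.ofReal_one, one_smul]
  have h2s : (2 * s) ≠ 0 := by positivity
  have hpos := lintegral_comp_add_mul h2s (image_add_mul_Ioo (c := c) hs) φ
  have hneg := lintegral_comp_add_mul (neg_ne_zero.mpr h2s) (image_sub_mul_Ioo (c := c) hs) φ
  rw [abs_neg, abs_of_pos (by positivity)] at hneg
  rw [abs_of_pos (by positivity)] at hpos
  have hsplit : ∫⁻ t in Set.Ioc (-1 / 2 : ℝ) (-1 / 2 + 1), φ (c + 2 * s * ‖(t : UnitAddCircle)‖) =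
      (∫⁻ t in Set.Ioo (-1 / 2 : ℝ) 0, φ (c + (-(2 * s)) * t)) +
        ∫⁻ t in Set.Ioo (0 : ℝ) (1 / 2), φ (c + 2 * s * t) := by
    rw [show (-1 / 2 + 1 : ℝ) = 1 / 2 by norm_num,
      ← Set.Ioc_union_Ioc_eq_Ioc (b := 0) (by norm_num) (by norm_num),
      lintegral_union measurableSet_Ioc (Set.Ioc_disjoint_Ioc_of_le le_rfl),
      ← setLIntegral_congr Ioo_ae_eq_Ioc, ← setLIntegral_congr Ioo_ae_eq_Ioc]
    congr 1
    · refine setLIntegral_congr_fun measurableSet_Ioo fun t ht => ?_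
      rw [norm_coe_unitAddCircle (abs_le.mpr ⟨by linarith [ht.1], by linarith [ht.2]⟩),
        abs_of_neg ht.2, neg_mul, mul_neg]
    · refine setLIntegral_congr_fun measurableSet_Ioo fun t ht => ?_
      rw [norm_coe_unitAddCircle (abs_le.mpr ⟨by linarith [ht.1], by linarith [ht.2]⟩),
        abs_of_pos ht.1]
  have hinv : ENNReal.ofReal s⁻¹ * ENNReal.ofReal (2 * s) = 2 := by
    rw [← ENNReal.ofReal_mul (by positivity), show s⁻¹ * (2 * s) = 2 by field_simp]
    simp
  rw [hvol, ← AddCircle.lintegral_preimage 1 (-1 / 2), hsplit]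
  refine (ENNReal.mul_right_inj (a := 2) (by norm_num) (by norm_num)).mp ?_
  rw [mul_add]
  nth_rewrite 1 2 [← hinv]
  rw [mul_assoc, mul_assoc, hpos, hneg, two_mul]

lemma measurePreserving_add_mul_norm (c : ℝ) {s : ℝ} (hs : 0 < s) :
    MeasurePreserving (fun θ : UnitAddCircle => c + 2 * s * ‖θ‖) AddCircle.haarAddCircle
      (ENNReal.ofReal s⁻¹ • volume.restrict (Set.Icc c (c + s))) := by
  have hm : Measurable fun θ : UnitAddCircle => c + 2 * s * ‖θ‖ := by fun_prop
  refine ⟨hm, Measure.ext fun A hA => ?_⟩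
  have h := lintegral_haarAddCircle_comp_norm c hs (A.indicator 1)
  rw [lintegral_indicator_one hA] at h
  rw [Measure.smul_apply, smul_eq_mul, ← h, ← lintegral_map (measurable_one.indicator hA) hm,
    lintegral_indicator_one hA]

section Torus

attribute [local instance] instMeasureSpaceUnitAddCircle

attribute [local instance] isProbabilityMeasure_volume_unitAddCircle

/-- The folding map pushes Haar measure to normalised Lebesgue measure on the cube. -/
lemma lintegral_comp_torusFold {d : ℕ} (c : EuclideanSpace ℝ (Fin d)) {s : ℝ} (hs : 0 < s)
    {φ : EuclideanSpace ℝ (Fin d) → ENNReal} (hφ : Measurable φ) :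
    ∫⁻ θ, φ (torusFold c s θ) = ENNReal.ofReal (s ^ d)⁻¹ *
      ∫⁻ y in {y : EuclideanSpace ℝ (Fin d) | ∀ i, y i ∈ Set.Icc (c i) (c i + s)}, φ y := by
  set μ : Fin d → Measure ℝ := fun i =>
    ENNReal.ofReal s⁻¹ • volume.restrict (Set.Icc (c i) (c i + s)) with hμ
  have hfin : ∀ i, IsFiniteMeasure (μ i) := fun i => Measure.smul_finite _ ENNReal.ofReal_ne_top
  have hpi : Measure.pi μ = ENNReal.ofReal (s ^ d)⁻¹ •
      volume.restrict (Set.univ.pi fun i => Set.Icc (c i) (c i + s)) := by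
    refine Measure.pi_eq fun A hA => ?_
    rw [Measure.smul_apply, volume_pi, Measure.restrict_pi_pi, Measure.pi_pi]
    simp only [hμ, Measure.smul_apply, smul_eq_mul]
    rw [Finset.prod_mul_distrib, Finset.prod_const, Finset.card_univ, Fintype.card_fin,
      ← ENNReal.ofReal_pow (by positivity), inv_pow]
  have hmp := measurePreserving_pi (fun _ : Fin d => (volume : Measure UnitAddCircle)) μ
    fun i => measurePreserving_add_mul_norm (c i) hs
  have hQ : MeasurableSet {y : EuclideanSpace ℝ (Fin d) | ∀ i, y i ∈ Set.Icc (c i) (c i + s)} := by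
    apply IsClosed.measurableSet
    simp only [Set.ofPred_forall]
    exact isClosed_iInter fun i => isClosed_Icc.preimage (by fun_prop)
  have hE := PiLp.volume_preserving_toLp (Fin d)
  have hφ' : Measurable fun x : Fin d → ℝ => φ (WithLp.toLp 2 x) := hφ.comp hE.measurable
  have h1 := hmp.lintegral_comp hφ'
  rw [hpi, lintegral_smul_measure, smul_eq_mul] at h1
  refine h1.trans ?_
  congr 1
  rw [← lintegral_indicator hQ, ← hE.lintegral_comp (hφ.indicator hQ),
    ← lintegral_indicator (MeasurableSet.univ_pi fun i => measurableSet_Icc)]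
  refine lintegral_congr fun x => ?_
  by_cases hx : ∀ i, x i ∈ Set.Icc (c i) (c i + s)
  · rw [Set.indicator_of_mem (Set.mem_univ_pi.mpr hx)]
    exact (Set.indicator_of_mem (s := {y : EuclideanSpace ℝ (Fin d) |
      ∀ i, y i ∈ Set.Icc (c i) (c i + s)}) hx _).symm
  · rw [Set.indicator_of_notMem (mt Set.mem_univ_pi.mp hx)]
    exact (Set.indicator_of_notMem (s := {y : EuclideanSpace ℝ (Fin d) |
      ∀ i, y i ∈ Set.Icc (c i) (c i + s)}) hx _).symm

end Torus

section Torus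

open UnitAddTorus

attribute [local instance] instMeasureSpaceUnitAddCircle

attribute [local instance] isProbabilityMeasure_volume_unitAddCircle

/-- Kinetic energy inequality on a cube for a measurable family of functions. -/
theorem cube_kinetic_lower_bound {d : ℕ} (hd : 1 ≤ d) {Ω : Type*} [MeasurableSpace Ω]
    {ν : Measure Ω} [SFinite ν] {F : Ω → EuclideanSpace ℝ (Fin d) → ℂ}
    (hF : StronglyMeasurable (Function.uncurry F)) (hFc : ∀ ω, ContDiff ℝ 1 (F ω))
    (hF' : ∀ i, Measurable fun p : Ω × EuclideanSpace ℝ (Fin d) =>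
      fderiv ℝ (F p.1) p.2 (EuclideanSpace.single i 1))
    (c : EuclideanSpace ℝ (Fin d)) {s : ℝ} (hs : 0 < s)
    {Q : Set (EuclideanSpace ℝ (Fin d))}
    (hQ : Q = {y : EuclideanSpace ℝ (Fin d) | ∀ i, y i ∈ Set.Icc (c i) (c i + s)})
    {M : ℝ} (hM : 0 < M) (hFM : ∫⁻ y in Q, ∫⁻ ω, ‖F ω y‖ₑ ^ 2 ∂ν = ENNReal.ofReal M)
    {ε : ℝ} (hε0 : 0 < ε) (hε1 : ε < 1) :
    ENNReal.ofReal (Real.pi ^ 2 / 4 * (d : ℝ) ^ ((2 : ℝ) - 2 / d) / ((d + 2) * (d + 4)) *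
        ε ^ ((1 : ℝ) + 4 / d) / M ^ ((2 : ℝ) / d)) *
        ∫⁻ y in Q, (∫⁻ ω, ‖F ω y‖ₑ ^ 2 ∂ν) ^ ((1 : ℝ) + 2 / d) ≤
      (∫⁻ y in Q, ∫⁻ ω, ∑ i, ‖fderiv ℝ (F ω) y (EuclideanSpace.single i 1)‖ₑ ^ 2 ∂ν) +
      ENNReal.ofReal (Real.pi ^ 2 / 4 * (d : ℝ) ^ ((2 : ℝ) - 2 / d) / ((d + 2) * (d + 4)) *
        (ε / (1 - ε)) ^ ((1 : ℝ) + 4 / d) * M / (s ^ d) ^ ((2 : ℝ) / d)) := by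
  have hd' : (0 : ℝ) < d := by exact_mod_cast hd
  have h1ε : 0 < 1 - ε := by linarith
  have hsd : 0 < s ^ d := by positivity
  have hfold := (continuous_torusFold c s).measurable
  set G : Ω → UnitAddTorus (Fin d) → ℂ := fun ω θ => F ω (torusFold c s θ)
  have hG : StronglyMeasurable (Function.uncurry G) :=
    hF.comp_measurable (measurable_fst.prodMk (hfold.comp measurable_snd))
  have hG2 : ∀ ω, MemLp (G ω) 2 volume := fun ω =>
    memLp_two_of_continuous ((hFc ω).continuous.comp (continuous_torusFold c s))
  have hρ : Measurable fun y => ∫⁻ ω, ‖F ω y‖ₑ ^ 2 ∂ν :=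
    Measurable.lintegral_prod_left' (f := fun p : Ω × EuclideanSpace ℝ (Fin d) => ‖F p.1 p.2‖ₑ ^ 2)
      (hF.enorm.pow_const 2)
  have hK : Measurable fun p : Ω × EuclideanSpace ℝ (Fin d) =>
      ∑ i, ‖fderiv ℝ (F p.1) p.2 (EuclideanSpace.single i 1)‖ₑ ^ 2 :=
    Finset.measurable_fun_sum _ fun i _ => (hF' i).enorm.pow_const 2
  have hGM : ∫⁻ θ, ∫⁻ ω, ‖G ω θ‖ₑ ^ 2 ∂ν = ENNReal.ofReal (M / s ^ d) := by
    rw [lintegral_comp_torusFold c hs hρ, ← hQ, hFM, ← ENNReal.ofReal_mul (by positivity)]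
    congr 1
    rw [div_eq_inv_mul]
  have h := torus_kinetic_lower_bound hd hG hG2 (by positivity) hGM
    (l := Real.pi ^ 2 / s ^ 2) (by positivity) hε0 hε1
  rw [lintegral_congr fun ω => tsum_frequency_eq_lintegral_fderiv (hFc ω) c hs] at h
  have hswap : AEMeasurable (Function.uncurry fun (ω : Ω) (θ : UnitAddTorus (Fin d)) =>
      ∑ i, ‖fderiv ℝ (F ω) (torusFold c s θ) (EuclideanSpace.single i 1)‖ₑ ^ 2)
      (ν.prod volume) :=
    (hK.comp (measurable_fst.prodMk (hfold.comp measurable_snd))).aemeasurable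
  rw [lintegral_lintegral_swap hswap,
    lintegral_comp_torusFold c hs (φ := fun y => (∫⁻ ω, ‖F ω y‖ₑ ^ 2 ∂ν) ^ ((1 : ℝ) + 2 / d))
      (hρ.pow_const _),
    lintegral_comp_torusFold c hs (φ := fun y => ∫⁻ ω,
      ∑ i, ‖fderiv ℝ (F ω) y (EuclideanSpace.single i 1)‖ₑ ^ 2 ∂ν) hK.lintegral_prod_left',
    ← hQ] at h
  have hs2 : (s ^ d) ^ ((2 : ℝ) / d) = s ^ 2 := by
    rw [← Real.rpow_natCast s d, ← Real.rpow_mul hs.le, mul_div_cancel₀ _ hd'.ne', Real.rpow_two]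
  have e1 : (M / s ^ d) ^ (-(2 : ℝ) / d) = s ^ 2 / M ^ ((2 : ℝ) / d) := by
    rw [Real.div_rpow hM.le hsd.le, neg_div, Real.rpow_neg hM.le, Real.rpow_neg hsd.le, hs2]
    field_simp
  rw [e1] at h
  have hinv0 : ENNReal.ofReal (s ^ d)⁻¹ ≠ 0 := by
    rw [ne_eq, ENNReal.ofReal_eq_zero, not_le]; positivity
  refine (ENNReal.mul_le_mul_iff_right hinv0 ENNReal.ofReal_ne_top).mp ?_
  rw [mul_add (ENNReal.ofReal (s ^ d)⁻¹), hs2, ← ENNReal.ofReal_mul (by positivity), mul_left_comm]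
  refine le_trans (le_of_eq ?_) (h.trans (le_of_eq ?_))
  · congr 2
    field_simp
  · congr 2
    field_simp

end Torus

section Particles

variable {d n : ℕ} {u : (Fin (n + 1) → EuclideanSpace ℝ (Fin d)) → ℂ}

lemma continuous_insertNth_pair (j : Fin (n + 1)) :
    Continuous fun p : (Fin n → EuclideanSpace ℝ (Fin d)) × EuclideanSpace ℝ (Fin d) =>
      (j.insertNth p.2 p.1 : Fin (n + 1) → EuclideanSpace ℝ (Fin d)) :=
  Continuous.finInsertNth j continuous_snd continuous_fst

lemma isClosedEmbedding_insertNth (j : Fin (n + 1)) (y : EuclideanSpace ℝ (Fin d)) :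
    Topology.IsClosedEmbedding fun z : Fin n → EuclideanSpace ℝ (Fin d) =>
      (j.insertNth y z : Fin (n + 1) → EuclideanSpace ℝ (Fin d)) := by
  have hleft : Function.LeftInverse
      (fun x : Fin (n + 1) → EuclideanSpace ℝ (Fin d) => fun k => x (j.succAbove k))
      (fun z => j.insertNth y z) := fun z => by
    funext k
    simp
  exact hleft.isClosedEmbedding (by fun_prop)
    ((continuous_insertNth_pair j).comp (by fun_prop : Continuous fun z => (z, y)))

lemma densityAt_eq_integral_insertNth (j : Fin (n + 1)) (y : EuclideanSpace ℝ (Fin d)) :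
    densityAt u j y = ∫ z : Fin n → EuclideanSpace ℝ (Fin d), ‖u (j.insertNth y z)‖ ^ 2 := by
  have hmp := volume_measurePreserving_piCongrLeft
    (fun _ : {k : Fin (n + 1) // k ≠ j} => EuclideanSpace ℝ (Fin d)) (finSuccAboveEquiv j)
  rw [densityAt, ← hmp.integral_comp (MeasurableEquiv.measurableEmbedding _)]
  congr 1
  funext z
  congr 3
  funext k
  refine Fin.succAboveCases j ?_ (fun l => ?_) k
  · simp
  · have h : (⟨j.succAbove l, Fin.succAbove_ne j l⟩ : {k : Fin (n + 1) // k ≠ j}) =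
        finSuccAboveEquiv j l := rfl
    rw [dif_neg (Fin.succAbove_ne j l), Fin.insertNth_apply_succAbove, h]
    exact Equiv.piCongrLeft_apply_apply
      (fun _ : {k : Fin (n + 1) // k ≠ j} => EuclideanSpace ℝ (Fin d)) (finSuccAboveEquiv j) z l

lemma ofReal_densityAt (hu : Continuous u) (hcs : HasCompactSupport u) (j : Fin (n + 1))
    (y : EuclideanSpace ℝ (Fin d)) :
    ENNReal.ofReal (densityAt u j y) =
      ∫⁻ z : Fin n → EuclideanSpace ℝ (Fin d), ‖u (j.insertNth y z)‖ₑ ^ 2 := by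
  have hemb := isClosedEmbedding_insertNth (d := d) j y
  have hinteg : Integrable fun z : Fin n → EuclideanSpace ℝ (Fin d) =>
      ‖u (j.insertNth y z)‖ ^ 2 := by
    refine Continuous.integrable_of_hasCompactSupport ((hu.comp hemb.continuous).norm.pow 2) ?_
    exact (hcs.comp_isClosedEmbedding hemb).comp_left (g := fun w : ℂ => ‖w‖ ^ 2) (by simp)
  rw [densityAt_eq_integral_insertNth, ofReal_integral_eq_lintegral_ofReal hinteg
    (Filter.Eventually.of_forall fun _ => sq_nonneg _)]
  simp_rw [ENNReal.ofReal_pow (norm_nonneg _), ofReal_norm]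

lemma hasFDerivAt_insertNth (j : Fin (n + 1)) (z : Fin n → EuclideanSpace ℝ (Fin d))
    (y : EuclideanSpace ℝ (Fin d)) :
    HasFDerivAt (fun y => (j.insertNth y z : Fin (n + 1) → EuclideanSpace ℝ (Fin d)))
      (ContinuousLinearMap.single ℝ (fun _ => EuclideanSpace ℝ (Fin d)) j) y := by
  have h : (fun y => (j.insertNth y z : Fin (n + 1) → EuclideanSpace ℝ (Fin d))) =
      fun y => j.insertNth 0 z +
        ContinuousLinearMap.single ℝ (fun _ => EuclideanSpace ℝ (Fin d)) j y := by
    funext y k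
    refine Fin.succAboveCases j ?_ (fun l => ?_) k <;> simp
  rw [h]
  exact (ContinuousLinearMap.hasFDerivAt _).const_add _

lemma fderiv_comp_insertNth (hu : Differentiable ℝ u) (j : Fin (n + 1))
    (z : Fin n → EuclideanSpace ℝ (Fin d)) (y v : EuclideanSpace ℝ (Fin d)) :
    fderiv ℝ (fun y => u (j.insertNth y z)) y v =
      fderiv ℝ u (j.insertNth y z) (Pi.single j v) := by
  have h : HasFDerivAt (fun y => u (j.insertNth y z)) _ y :=
    (hu _).hasFDerivAt.comp y (hasFDerivAt_insertNth j z y)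
  rw [h.fderiv]
  rfl

lemma contDiff_comp_insertNth (hu : ContDiff ℝ 1 u) (j : Fin (n + 1))
    (z : Fin n → EuclideanSpace ℝ (Fin d)) :
    ContDiff ℝ 1 fun y => u (j.insertNth y z) := by
  refine hu.comp ?_
  rw [contDiff_pi]
  intro k
  refine Fin.succAboveCases j ?_ (fun l => ?_) k
  · simpa using contDiff_fun_id
  · simpa using contDiff_const

/-- Measurability of a function of a particle label, the remaining particles and a position. -/
lemma measurable_of_continuous_insertNth
    {E : Type*} [TopologicalSpace E] [MeasurableSpace E] [BorelSpace E]
    {g : Fin (n + 1) → (Fin (n + 1) → EuclideanSpace ℝ (Fin d)) → E} (hg : ∀ j, Continuous (g j)) :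
    Measurable fun p : (Fin (n + 1) × (Fin n → EuclideanSpace ℝ (Fin d))) ×
      EuclideanSpace ℝ (Fin d) => g p.1.1 (p.1.1.insertNth p.2 p.1.2) := by
  have h : Measurable fun q : Fin (n + 1) ×
      ((Fin n → EuclideanSpace ℝ (Fin d)) × EuclideanSpace ℝ (Fin d)) =>
      g q.1 (q.1.insertNth q.2.2 q.2.1) :=
    measurable_from_prod_countable_right fun j =>
      ((hg j).comp (continuous_insertNth_pair j)).measurable
  exact h.comp MeasurableEquiv.prodAssoc.measurable

lemma lintegral_count_prod {α : Type*} [MeasurableSpace α] {μ : Measure α} [SFinite μ]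
    {g : Fin (n + 1) × α → ENNReal} (hg : Measurable g) :
    ∫⁻ ω, g ω ∂((Measure.count : Measure (Fin (n + 1))).prod μ) = ∑ j, ∫⁻ z, g (j, z) ∂μ := by
  rw [lintegral_prod _ hg.aemeasurable, lintegral_count, tsum_fintype]

/-- The local kinetic energy of one particle as an iterated integral. -/
lemma ofReal_kinetic_eq (hu : ContDiff ℝ 1 u) (hcs : HasCompactSupport u)
    {Q : Set (EuclideanSpace ℝ (Fin d))} (hQ : MeasurableSet Q) (j : Fin (n + 1)) :
    ENNReal.ofReal (∫ x : Fin (n + 1) → EuclideanSpace ℝ (Fin d),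
        (∑ i : Fin d, ‖fderiv ℝ u x (Pi.single j (EuclideanSpace.single i (1 : ℝ)))‖ ^ 2) *
          Set.indicator Q (fun _ => (1 : ℝ)) (x j)) =
      ∫⁻ y in Q, ∫⁻ z : Fin n → EuclideanSpace ℝ (Fin d), ∑ i : Fin d,
        ‖fderiv ℝ u (j.insertNth y z) (Pi.single j (EuclideanSpace.single i 1))‖ₑ ^ 2 := by
  set g : (Fin (n + 1) → EuclideanSpace ℝ (Fin d)) → ℝ := fun x =>
    ∑ i : Fin d, ‖fderiv ℝ u x (Pi.single j (EuclideanSpace.single i (1 : ℝ)))‖ ^ 2 with hg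
  have hg0 : ∀ x, 0 ≤ g x := fun x => Finset.sum_nonneg fun _ _ => sq_nonneg _
  have hgc : Continuous g := continuous_finsetSum _ fun i _ =>
    (((hu.continuous_fderiv one_ne_zero).clm_apply continuous_const).norm.pow 2)
  have hgs : HasCompactSupport g := by
    refine (hcs.fderiv (𝕜 := ℝ)).comp_left (g := fun L :
      (Fin (n + 1) → EuclideanSpace ℝ (Fin d)) →L[ℝ] ℂ =>
        ∑ i : Fin d, ‖L (Pi.single j (EuclideanSpace.single i (1 : ℝ)))‖ ^ 2) ?_
    simp
  have hgi : Integrable g := hgc.integrable_of_hasCompactSupport hgs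
  have hQj : MeasurableSet ((fun x : Fin (n + 1) → EuclideanSpace ℝ (Fin d) => x j) ⁻¹' Q) :=
    measurable_pi_apply j hQ
  have hind : ∀ x, g x * Set.indicator Q (fun _ => (1 : ℝ)) (x j) =
      ((fun x : Fin (n + 1) → EuclideanSpace ℝ (Fin d) => x j) ⁻¹' Q).indicator g x := by
    intro x
    by_cases hx : x j ∈ Q <;> simp [Set.indicator, hx]
  have hge : ∀ x, ENNReal.ofReal (g x) =
      ∑ i : Fin d, ‖fderiv ℝ u x (Pi.single j (EuclideanSpace.single i 1))‖ₑ ^ 2 := by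
    intro x
    rw [hg, ENNReal.ofReal_sum_of_nonneg fun _ _ => sq_nonneg _]
    simp_rw [ENNReal.ofReal_pow (norm_nonneg _), ofReal_norm]
  have hgm : Measurable fun x => ENNReal.ofReal (g x) := hgc.measurable.ennreal_ofReal
  simp_rw [← hge]
  rw [integral_congr_ae (Filter.Eventually.of_forall hind)]
  rw [integral_indicator hQj, ofReal_integral_eq_lintegral_ofReal hgi.integrableOn
    (Filter.Eventually.of_forall hg0), ← lintegral_indicator hQj, ← lintegral_indicator hQ]
  have hmp := (volume_preserving_piFinSuccAbove (fun _ => EuclideanSpace ℝ (Fin d)) j).symm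
  rw [← hmp.lintegral_comp (hgm.indicator hQj), Measure.volume_eq_prod, lintegral_prod]
  · refine lintegral_congr fun y => ?_
    by_cases hy : y ∈ Q
    · rw [Set.indicator_of_mem hy]
      refine lintegral_congr fun z => ?_
      rw [Set.indicator_of_mem]
      · rfl
      · simpa [Fin.insertNthEquiv] using hy
    · rw [Set.indicator_of_notMem hy]
      refine (lintegral_congr fun z => ?_).trans lintegral_zero
      rw [Set.indicator_of_notMem]
      simpa [Fin.insertNthEquiv] using hy
  · exact ((hgm.indicator hQj).comp hmp.measurable).aemeasurable

lemma lintegral_count_prod_insertNth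
    {g : Fin (n + 1) → (Fin (n + 1) → EuclideanSpace ℝ (Fin d)) → ENNReal}
    (hg : ∀ j, Continuous (g j)) (y : EuclideanSpace ℝ (Fin d)) :
    ∫⁻ ω, g ω.1 (ω.1.insertNth y ω.2) ∂((Measure.count : Measure (Fin (n + 1))).prod
        (volume : Measure (Fin n → EuclideanSpace ℝ (Fin d)))) =
      ∑ j, ∫⁻ z : Fin n → EuclideanSpace ℝ (Fin d), g j (j.insertNth y z) :=
  lintegral_count_prod ((measurable_of_continuous_insertNth hg).comp
    (measurable_prodMk_right (y := y)))

lemma ofReal_sum_densityAt (hu : Continuous u) (hcs : HasCompactSupport u)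
    (y : EuclideanSpace ℝ (Fin d)) :
    ENNReal.ofReal (∑ j, densityAt u j y) =
      ∫⁻ ω, ‖u (ω.1.insertNth y ω.2)‖ₑ ^ 2
        ∂((Measure.count : Measure (Fin (n + 1))).prod
          (volume : Measure (Fin n → EuclideanSpace ℝ (Fin d)))) := by
  rw [lintegral_count_prod_insertNth (g := fun _ x => ‖u x‖ₑ ^ 2)
      (fun _ => (ENNReal.continuous_pow 2).comp hu.enorm),
    ENNReal.ofReal_sum_of_nonneg (f := fun j => densityAt u j y)
      fun j _ => integral_nonneg fun _ => sq_nonneg _]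
  exact Finset.sum_congr rfl fun j _ => ofReal_densityAt hu hcs j y

/-- The local kinetic energy of all particles as an integral over the labelled remaining
particles. -/
lemma lintegral_kinetic_eq_ofReal_sum (hu : ContDiff ℝ 1 u) (hcs : HasCompactSupport u)
    {Q : Set (EuclideanSpace ℝ (Fin d))} (hQ : MeasurableSet Q) :
    ∫⁻ y in Q, ∫⁻ ω, ∑ i, ‖fderiv ℝ (fun y => u (ω.1.insertNth y ω.2)) y
        (EuclideanSpace.single i 1)‖ₑ ^ 2
        ∂((Measure.count : Measure (Fin (n + 1))).prod
          (volume : Measure (Fin n → EuclideanSpace ℝ (Fin d)))) =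
      ENNReal.ofReal (∑ j, ∫ x : Fin (n + 1) → EuclideanSpace ℝ (Fin d),
        (∑ i : Fin d, ‖fderiv ℝ u x (Pi.single j (EuclideanSpace.single i (1 : ℝ)))‖ ^ 2) *
          Set.indicator Q (fun _ => (1 : ℝ)) (x j)) := by
  let g : Fin (n + 1) → (Fin (n + 1) → EuclideanSpace ℝ (Fin d)) → ENNReal := fun j x =>
    ∑ i : Fin d, ‖fderiv ℝ u x (Pi.single j (EuclideanSpace.single i 1))‖ₑ ^ 2
  have hg : ∀ j, Continuous (g j) := fun j => continuous_finsetSum _ fun i _ =>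
    (ENNReal.continuous_pow 2).comp
      ((hu.continuous_fderiv one_ne_zero).clm_apply continuous_const).enorm
  have hgj : ∀ j, Measurable fun y => ∫⁻ z : Fin n → EuclideanSpace ℝ (Fin d),
      g j (j.insertNth y z) := fun j =>
    (((hg j).measurable.comp (continuous_insertNth_pair j).measurable).comp
      measurable_swap).lintegral_prod_right'
  have hfd : ∀ (ω : Fin (n + 1) × (Fin n → EuclideanSpace ℝ (Fin d)))
      (y : EuclideanSpace ℝ (Fin d)),
      ∑ i, ‖fderiv ℝ (fun y => u (ω.1.insertNth y ω.2)) y (EuclideanSpace.single i 1)‖ₑ ^ 2 =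
        g ω.1 (ω.1.insertNth y ω.2) := fun ω y => Finset.sum_congr rfl fun i _ =>
    congrArg (fun w : ℂ => ‖w‖ₑ ^ 2)
      (fderiv_comp_insertNth (hu.differentiable one_ne_zero) ω.1 ω.2 y _)
  symm
  calc ENNReal.ofReal (∑ j, ∫ x : Fin (n + 1) → EuclideanSpace ℝ (Fin d),
        (∑ i : Fin d, ‖fderiv ℝ u x (Pi.single j (EuclideanSpace.single i (1 : ℝ)))‖ ^ 2) *
          Set.indicator Q (fun _ => (1 : ℝ)) (x j))
      = ∑ j, ENNReal.ofReal (∫ x : Fin (n + 1) → EuclideanSpace ℝ (Fin d),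
        (∑ i : Fin d, ‖fderiv ℝ u x (Pi.single j (EuclideanSpace.single i (1 : ℝ)))‖ ^ 2) *
          Set.indicator Q (fun _ => (1 : ℝ)) (x j)) :=
        ENNReal.ofReal_sum_of_nonneg fun j _ => integral_nonneg fun x =>
          mul_nonneg (Finset.sum_nonneg fun _ _ => sq_nonneg _)
            (Set.indicator_nonneg (fun _ _ => zero_le_one) _)
    _ = ∑ j, ∫⁻ y in Q, ∫⁻ z : Fin n → EuclideanSpace ℝ (Fin d), g j (j.insertNth y z) :=
        Finset.sum_congr rfl fun j _ => ofReal_kinetic_eq hu hcs hQ j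
    _ = ∫⁻ y in Q, ∑ j, ∫⁻ z : Fin n → EuclideanSpace ℝ (Fin d), g j (j.insertNth y z) :=
        (lintegral_finsetSum _ fun j _ => hgj j).symm
    _ = _ := lintegral_congr fun y => by
        simp_rw [hfd]
        exact (lintegral_count_prod_insertNth hg y).symm

end Particles

/-- **Local uncertainty principle.** For any `N`-particle wave function
`u ∈ C_c^∞((ℝ^d)^N)` with one-particle density `ρ = ∑_j densityAt u j`, a cube `Q` of
side `s` with `∫_Q ρ > 0`, and any `ε ∈ (0,1)`, the free local kinetic energy
`T₀^Q = (1/2)∑_j ∫ ‖∇_j u‖² χ_Q(x_j)` satisfies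
`T₀^Q ≥ (C'_d/2) ε^{1+4/d} (∫_Q ρ^{1+2/d})/(∫_Q ρ)^{2/d}
       - (C'_d/2)(1 + (ε/(1-ε))^{1+4/d}) (∫_Q ρ)/|Q|^{2/d}`,
with `C'_d = (π²/4) d^{2-2/d}/((d+2)(d+4))` (`= π²/60` for `d = 1`). -/
theorem local_uncertainty_principle
    (d N : ℕ) (hd : 1 ≤ d) (hN : 1 ≤ N)
    (c : EuclideanSpace ℝ (Fin d)) (s : ℝ) (hs : 0 < s)
    (Q : Set (EuclideanSpace ℝ (Fin d)))
    (hQ : Q = {y : EuclideanSpace ℝ (Fin d) | ∀ i, y i ∈ Set.Icc (c i) (c i + s)})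
    (u : (Fin N → EuclideanSpace ℝ (Fin d)) → ℂ)
    (hu : ContDiff ℝ (⊤ : ℕ∞) u) (hcs : HasCompactSupport u)
    (hpos : 0 < ∫ y in Q, ∑ j : Fin N, densityAt u j y)
    (ε : ℝ) (hε0 : 0 < ε) (hε1 : ε < 1) :
    (1 / 2) * ∑ j : Fin N, ∫ x : Fin N → EuclideanSpace ℝ (Fin d),
        (∑ i : Fin d,
          ‖fderiv ℝ u x (Pi.single j (EuclideanSpace.single i (1 : ℝ)))‖ ^ 2) *
          Set.indicator Q (fun _ => (1 : ℝ)) (x j)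
      ≥ (Real.pi ^ 2 / 4 * (d : ℝ) ^ ((2 : ℝ) - 2 / (d : ℝ)) /
            (((d : ℝ) + 2) * ((d : ℝ) + 4))) / 2 * ε ^ ((1 : ℝ) + 4 / (d : ℝ)) *
          (∫ y in Q, (∑ j : Fin N, densityAt u j y) ^ ((1 : ℝ) + 2 / (d : ℝ))) /
          (∫ y in Q, ∑ j : Fin N, densityAt u j y) ^ ((2 : ℝ) / (d : ℝ))
        - (Real.pi ^ 2 / 4 * (d : ℝ) ^ ((2 : ℝ) - 2 / (d : ℝ)) /
            (((d : ℝ) + 2) * ((d : ℝ) + 4))) / 2 *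
          (1 + (ε / (1 - ε)) ^ ((1 : ℝ) + 4 / (d : ℝ))) *
          (∫ y in Q, ∑ j : Fin N, densityAt u j y) /
          ((s ^ d : ℝ) ^ ((2 : ℝ) / (d : ℝ))) := by
  obtain ⟨n, rfl⟩ : ∃ n, N = n + 1 := ⟨N - 1, by omega⟩
  have hu1 : ContDiff ℝ 1 u := hu.of_le (by exact_mod_cast le_top)
  have hQm : MeasurableSet Q := by
    rw [hQ]
    apply IsClosed.measurableSet
    simp only [Set.ofPred_forall]
    exact isClosed_iInter fun i => isClosed_Icc.preimage (by fun_prop)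
  set ν : Measure (Fin (n + 1) × (Fin n → EuclideanSpace ℝ (Fin d))) :=
    Measure.count.prod volume with hν
  set F : Fin (n + 1) × (Fin n → EuclideanSpace ℝ (Fin d)) → EuclideanSpace ℝ (Fin d) → ℂ :=
    fun ω y => u (ω.1.insertNth y ω.2) with hF
  have hFm : Measurable (Function.uncurry F) :=
    measurable_of_continuous_insertNth (g := fun _ => u) fun _ => hu.continuous
  have hFd : ∀ ω y v, fderiv ℝ (F ω) y v =
      fderiv ℝ u (ω.1.insertNth y ω.2) (Pi.single ω.1 v) := fun ω y v =>
    fderiv_comp_insertNth (hu1.differentiable one_ne_zero) ω.1 ω.2 y v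
  have hF' : ∀ i, Measurable fun p : (Fin (n + 1) × (Fin n → EuclideanSpace ℝ (Fin d))) ×
      EuclideanSpace ℝ (Fin d) => fderiv ℝ (F p.1) p.2 (EuclideanSpace.single i 1) := by
    intro i
    simp_rw [hFd]
    exact measurable_of_continuous_insertNth
      (g := fun j x => fderiv ℝ u x (Pi.single j (EuclideanSpace.single i 1)))
      fun j => (hu1.continuous_fderiv one_ne_zero).clm_apply continuous_const
  set ρ : EuclideanSpace ℝ (Fin d) → ℝ := fun y => ∑ j, densityAt u j y with hρ
  have hρ0 : ∀ y, 0 ≤ ρ y := fun y => Finset.sum_nonneg fun j _ =>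
    integral_nonneg fun _ => sq_nonneg _
  have hρF : ∀ y, ENNReal.ofReal (ρ y) = ∫⁻ ω, ‖F ω y‖ₑ ^ 2 ∂ν :=
    ofReal_sum_densityAt hu.continuous hcs
  have hρm : Measurable ρ := by
    have h : ρ = fun y => (∫⁻ ω, ‖F ω y‖ₑ ^ 2 ∂ν).toReal := by
      funext y
      rw [← hρF, ENNReal.toReal_ofReal (hρ0 y)]
    rw [h]
    exact (Measurable.lintegral_prod_left' (hFm.enorm.pow_const 2)).ennreal_toReal
  set M : ℝ := ∫ y in Q, ρ y with hM
  have hρi : IntegrableOn ρ Q := by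
    by_contra h
    exact hpos.ne' (integral_undef h)
  have hFM : ∫⁻ y in Q, ∫⁻ ω, ‖F ω y‖ₑ ^ 2 ∂ν = ENNReal.ofReal M := by
    simp_rw [← hρF]
    exact (ofReal_integral_eq_lintegral_ofReal hρi (Filter.Eventually.of_forall hρ0)).symm
  have h := cube_kinetic_lower_bound hd hFm.stronglyMeasurable
    (fun ω => contDiff_comp_insertNth hu1 ω.1 ω.2) hF' c hs hQ hpos hFM hε0 hε1
  set T : Fin (n + 1) → ℝ := fun j => ∫ x : Fin (n + 1) → EuclideanSpace ℝ (Fin d),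
    (∑ i : Fin d, ‖fderiv ℝ u x (Pi.single j (EuclideanSpace.single i (1 : ℝ)))‖ ^ 2) *
      Set.indicator Q (fun _ => (1 : ℝ)) (x j) with hT
  have hT0 : ∀ j, 0 ≤ T j := fun j => integral_nonneg fun x =>
    mul_nonneg (Finset.sum_nonneg fun _ _ => sq_nonneg _)
      (Set.indicator_nonneg (fun _ _ => zero_le_one) _)
  have hK : ∫⁻ y in Q, ∫⁻ ω, ∑ i, ‖fderiv ℝ (F ω) y (EuclideanSpace.single i 1)‖ₑ ^ 2 ∂ν =
      ENNReal.ofReal (∑ j, T j) := lintegral_kinetic_eq_ofReal_sum hu1 hcs hQm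
  have hP : ∫⁻ y in Q, (∫⁻ ω, ‖F ω y‖ₑ ^ 2 ∂ν) ^ ((1 : ℝ) + 2 / d) =
      ∫⁻ y in Q, ENNReal.ofReal (ρ y ^ ((1 : ℝ) + 2 / d)) := by
    simp_rw [← hρF]
    exact lintegral_congr fun y => ENNReal.ofReal_rpow_of_nonneg (hρ0 y) (by positivity)
  have hPr : ∫ y in Q, ρ y ^ ((1 : ℝ) + 2 / d) =
      (∫⁻ y in Q, ENNReal.ofReal (ρ y ^ ((1 : ℝ) + 2 / d))).toReal :=
    integral_eq_lintegral_of_nonneg_ae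
      (Filter.Eventually.of_forall fun y => Real.rpow_nonneg (hρ0 y) _)
      (hρm.pow_const _).aestronglyMeasurable
  have hd' : (0 : ℝ) < d := by exact_mod_cast hd
  have h1ε : 0 < 1 - ε := by linarith
  set C : ℝ := Real.pi ^ 2 / 4 * (d : ℝ) ^ ((2 : ℝ) - 2 / d) / ((d + 2) * (d + 4))
  have hC : 0 < C := by positivity
  rw [hK, hP, ← ENNReal.ofReal_add (Finset.sum_nonneg fun j _ => hT0 j) (by positivity)] at h
  have hreal := ENNReal.toReal_mono ENNReal.ofReal_ne_top h
  rw [ENNReal.toReal_mul, ← hPr, ENNReal.toReal_ofReal (by positivity),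
    ENNReal.toReal_ofReal (add_nonneg (Finset.sum_nonneg fun j _ => hT0 j) (by positivity))]
    at hreal
  have hslack : 0 ≤ C * M / (s ^ d) ^ ((2 : ℝ) / d) := by positivity
  have e1 : C / 2 * ε ^ ((1 : ℝ) + 4 / d) * (∫ y in Q, ρ y ^ ((1 : ℝ) + 2 / d)) /
      M ^ ((2 : ℝ) / d) = C * ε ^ ((1 : ℝ) + 4 / d) / M ^ ((2 : ℝ) / d) *
        (∫ y in Q, ρ y ^ ((1 : ℝ) + 2 / d)) / 2 := by ring
  have e2 : C / 2 * (1 + (ε / (1 - ε)) ^ ((1 : ℝ) + 4 / d)) * M / (s ^ d) ^ ((2 : ℝ) / d) =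
      (C * M / (s ^ d) ^ ((2 : ℝ) / d) +
        C * (ε / (1 - ε)) ^ ((1 : ℝ) + 4 / d) * M / (s ^ d) ^ ((2 : ℝ) / d)) / 2 := by ring
  rw [ge_iff_le, e1, e2]
  linarith
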